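/- arXiv:1603.08487 — 2 statements merged into one kernel-verified Lean document; each statement's English description precedes it below -/
import Mathlib

section
/- The set 𝖣_n is a K-linear basis of Y_{d,n}^B; consequently the dimension of Y_{d,n}^B over K equals 2^n d^n n!. -/
noncomputable section

/-- The field `K = ℂ(u,v)` of rational functions in two indeterminates over `ℂ`. -/
abbrev Kf : Type := FractionRing (MvPolynomial (Fin 2) ℂ)

/-- The indeterminate `u`. -/
def uu : Kf := algebraMap (MvPolynomial (Fin 2) ℂ) Kf (MvPolynomial.X 0)

/-- The indeterminate `v`. -/
def vv : Kf := algebraMap (MvPolynomial (Fin 2) ℂ) Kf (MvPolynomial.X 1)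

/-- Generators of the framization of the Hecke algebra of type B on `n` strands:
`b` is the generator `b₁`, `g i` is the braiding generator `g_{i+1}` (`i : Fin (n-1)`),
and `t j` is the framing generator `t_{j+1}` (`j : Fin n`). -/
inductive Gen (n : ℕ) : Type
  | b : Gen n
  | g : Fin (n - 1) → Gen n
  | t : Fin n → Gen n

/-- The free algebra on the generators. -/
abbrev FA (n : ℕ) : Type := FreeAlgebra Kf (Gen n)

/-- The generator `b₁` in the free algebra. -/
def Bb (n : ℕ) : FA n := FreeAlgebra.ι Kf Gen.b

/-- The generator `g_i` (for `1 ≤ i ≤ n-1`) in the free algebra; junk value `1` out of range. -/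
def Gg (n i : ℕ) : FA n :=
  if h : 1 ≤ i ∧ i ≤ n - 1 then FreeAlgebra.ι Kf (Gen.g ⟨i - 1, by omega⟩) else 1

/-- The generator `t_j` (for `1 ≤ j ≤ n`) in the free algebra; junk value `1` out of range. -/
def Tt (n j : ℕ) : FA n :=
  if h : 1 ≤ j ∧ j ≤ n then FreeAlgebra.ι Kf (Gen.t ⟨j - 1, by omega⟩) else 1

/-- The element `e_i = (1/d) ∑_{m=0}^{d-1} t_i^m t_{i+1}^{d-m}` in the free algebra. -/
def eF (d n i : ℕ) : FA n :=
  (d : Kf)⁻¹ • ∑ m ∈ Finset.range d, Tt n i ^ m * Tt n (i + 1) ^ (d - m)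

/-- The element `f₁ = (1/d) ∑_{m=0}^{d-1} t₁^m` in the free algebra. -/
def fF (d n : ℕ) : FA n :=
  (d : Kf)⁻¹ • ∑ m ∈ Finset.range d, Tt n 1 ^ m

/-- The action of the simple transposition `s_i` on indices: swaps `i` and `i+1`. -/
def sAct (i j : ℕ) : ℕ := if j = i then i + 1 else if j = i + 1 then i else j

/-- The defining relations of the framization `Y_{d,n}^B` of the Hecke algebra of type B. -/
inductive YBrel (d n : ℕ) : FA n → FA n → Prop
  | gg : ∀ i j : ℕ, 1 ≤ i → i ≤ n - 1 → 1 ≤ j → j ≤ n - 1 → (i + 1 < j ∨ j + 1 < i) →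
      YBrel d n (Gg n i * Gg n j) (Gg n j * Gg n i)
  | braid : ∀ i : ℕ, 1 ≤ i → i ≤ n - 2 →
      YBrel d n (Gg n i * Gg n (i + 1) * Gg n i) (Gg n (i + 1) * Gg n i * Gg n (i + 1))
  | bg : ∀ i : ℕ, 2 ≤ i → i ≤ n - 1 → YBrel d n (Bb n * Gg n i) (Gg n i * Bb n)
  | bgbg : YBrel d n (Bb n * Gg n 1 * Bb n * Gg n 1) (Gg n 1 * Bb n * Gg n 1 * Bb n)
  | tt : ∀ i j : ℕ, 1 ≤ i → i ≤ n → 1 ≤ j → j ≤ n →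
      YBrel d n (Tt n i * Tt n j) (Tt n j * Tt n i)
  | tg : ∀ i j : ℕ, 1 ≤ i → i ≤ n - 1 → 1 ≤ j → j ≤ n →
      YBrel d n (Tt n j * Gg n i) (Gg n i * Tt n (sAct i j))
  | tb : ∀ i : ℕ, 1 ≤ i → i ≤ n → YBrel d n (Tt n i * Bb n) (Bb n * Tt n i)
  | td : ∀ i : ℕ, 1 ≤ i → i ≤ n → YBrel d n (Tt n i ^ d) 1
  | gsq : ∀ i : ℕ, 1 ≤ i → i ≤ n - 1 →
      YBrel d n (Gg n i ^ 2) (1 + (uu - uu⁻¹) • (eF d n i * Gg n i))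
  | bsq : YBrel d n (Bb n ^ 2) (1 + (vv - vv⁻¹) • (fF d n * Bb n))

/-- The framization of the Hecke algebra of type B, `Y_{d,n}^B`. -/
abbrev YB (d n : ℕ) : Type := RingQuot (YBrel d n)

instance (d n : ℕ) : Ring (YB d n) := RingQuot.instRing (YBrel d n)

instance (d n : ℕ) : Algebra Kf (YB d n) := RingQuot.instAlgebra _

instance (d n : ℕ) : Module Kf (YB d n) := Algebra.toModule

/-- The canonical projection from the free algebra onto `Y_{d,n}^B`. -/
def mkY (d n : ℕ) : FA n →ₐ[Kf] YB d n := RingQuot.mkAlgHom Kf (YBrel d n)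

/-- The generator `b₁` of `Y_{d,n}^B`. -/
def bY (d n : ℕ) : YB d n := mkY d n (Bb n)

/-- The generator `g_i` of `Y_{d,n}^B`. -/
def gY (d n : ℕ) (i : ℕ) : YB d n := mkY d n (Gg n i)

/-- The generator `t_j` of `Y_{d,n}^B`. -/
def tY (d n : ℕ) (j : ℕ) : YB d n := mkY d n (Tt n j)

/-- The idempotent `e_i` of `Y_{d,n}^B`. -/
def eY (d n : ℕ) (i : ℕ) : YB d n := mkY d n (eF d n i)

/-- The idempotent `f₁` of `Y_{d,n}^B`. -/
def fY (d n : ℕ) : YB d n := mkY d n (fF d n)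

/-- The element `g_i⁻¹ = g_i - (u - u⁻¹) e_i`. -/
def gInv (d n i : ℕ) : YB d n := gY d n i - (uu - uu⁻¹) • eY d n i

/-- The elements `b_k := g_{k-1} ⋯ g_1 b_1 g_1⁻¹ ⋯ g_{k-1}⁻¹` for `2 ≤ k ≤ n`,
defined by `b_k = g_{k-1} b_{k-1} g_{k-1}⁻¹`; with `b_1` the generator `b₁`. -/
def bk (d n : ℕ) : ℕ → YB d n
  | 0 => 1
  | 1 => bY d n
  | (k + 2) => gY d n (k + 1) * bk d n (k + 1) * gInv d n (k + 1)

/-- The elements `b̄_k := g_{k-1} ⋯ g_1 b_1 g_1 ⋯ g_{k-1}`, defined by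
`b̄_k = g_{k-1} b̄_{k-1} g_{k-1}`, with `b̄_1 = b_1`. -/
def bbar (d n : ℕ) : ℕ → YB d n
  | 0 => 1
  | 1 => bY d n
  | (k + 2) => gY d n (k + 1) * bbar d n (k + 1) * gY d n (k + 1)

/-- The subsets `N_{d,k}` of `Y_{d,n}^B`:
`N_{d,1} = {t₁^m, b̄₁ t₁^m}` and `N_{d,k} = {t_k^m, b̄_k t_k^m, g_{k-1} x : x ∈ N_{d,k-1}}`. -/
def Nset (d n : ℕ) : ℕ → Set (YB d n)
  | 0 => {1}
  | 1 => {x | ∃ m ≤ d - 1, x = tY d n 1 ^ m ∨ x = bbar d n 1 * tY d n 1 ^ m}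
  | (k + 2) => {x |
      (∃ m ≤ d - 1, x = tY d n (k + 2) ^ m ∨ x = bbar d n (k + 2) * tY d n (k + 2) ^ m) ∨
      ∃ y ∈ Nset d n (k + 1), x = gY d n (k + 1) * y}

/-- The set `𝖣_n` of all products `𝔫_1 𝔫_2 ⋯ 𝔫_n` with `𝔫_i ∈ N_{d,i}`. -/
def Dset (d n : ℕ) : Set (YB d n) :=
  {x | ∃ f : Fin n → YB d n, (∀ i : Fin n, f i ∈ Nset d n (i.val + 1)) ∧
    x = (List.ofFn f).prod}

section Relations

variable {d n : ℕ}

theorem mkY_eq_of_rel {x y : FA n} (h : YBrel d n x y) : mkY d n x = mkY d n y :=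
  RingQuot.mkAlgHom_rel Kf h

theorem gY_commute {i j : ℕ} (hi : 1 ≤ i) (hi' : i ≤ n - 1) (hj : 1 ≤ j) (hj' : j ≤ n - 1)
    (hij : i + 1 < j ∨ j + 1 < i) : Commute (gY d n i) (gY d n j) := by
  have := mkY_eq_of_rel (YBrel.gg (d := d) i j hi hi' hj hj' hij)
  simp only [map_mul] at this
  exact this

theorem gY_braid {i : ℕ} (hi : 1 ≤ i) (hi' : i ≤ n - 2) :
    gY d n i * gY d n (i + 1) * gY d n i = gY d n (i + 1) * gY d n i * gY d n (i + 1) := by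
  have := mkY_eq_of_rel (YBrel.braid (d := d) i hi hi')
  simp only [map_mul] at this
  exact this

theorem bY_commute_gY {i : ℕ} (hi : 2 ≤ i) (hi' : i ≤ n - 1) :
    Commute (bY d n) (gY d n i) := by
  have := mkY_eq_of_rel (YBrel.bg (d := d) i hi hi')
  simp only [map_mul] at this
  exact this

theorem bY_gY_braid : bY d n * gY d n 1 * bY d n * gY d n 1 =
    gY d n 1 * bY d n * gY d n 1 * bY d n := by
  have := mkY_eq_of_rel (YBrel.bgbg (d := d) (n := n))
  simp only [map_mul] at this
  exact this

theorem tY_commute {i j : ℕ} (hi : 1 ≤ i) (hi' : i ≤ n) (hj : 1 ≤ j) (hj' : j ≤ n) :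
    Commute (tY d n i) (tY d n j) := by
  have := mkY_eq_of_rel (YBrel.tt (d := d) i j hi hi' hj hj')
  simp only [map_mul] at this
  exact this

theorem tY_mul_gY {i j : ℕ} (hi : 1 ≤ i) (hi' : i ≤ n - 1) (hj : 1 ≤ j) (hj' : j ≤ n) :
    tY d n j * gY d n i = gY d n i * tY d n (sAct i j) := by
  have := mkY_eq_of_rel (YBrel.tg (d := d) i j hi hi' hj hj')
  simp only [map_mul] at this
  exact this

theorem tY_commute_bY {i : ℕ} (hi : 1 ≤ i) (hi' : i ≤ n) :
    Commute (tY d n i) (bY d n) := by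
  have := mkY_eq_of_rel (YBrel.tb (d := d) i hi hi')
  simp only [map_mul] at this
  exact this

theorem tY_pow_d {i : ℕ} (hi : 1 ≤ i) (hi' : i ≤ n) : tY d n i ^ d = 1 := by
  have := mkY_eq_of_rel (YBrel.td (d := d) i hi hi')
  simp only [map_pow, map_one] at this
  exact this

theorem gY_mul_self {i : ℕ} (hi : 1 ≤ i) (hi' : i ≤ n - 1) :
    gY d n i * gY d n i = 1 + (uu - uu⁻¹) • (eY d n i * gY d n i) := by
  have := mkY_eq_of_rel (YBrel.gsq (d := d) i hi hi')
  simp only [map_one, map_add, map_smul, map_mul, pow_two] at this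
  exact this

theorem bY_mul_self :
    bY d n * bY d n = 1 + (vv - vv⁻¹) • (fY d n * bY d n) := by
  have := mkY_eq_of_rel (YBrel.bsq (d := d) (n := n))
  simp only [map_one, map_add, map_smul, map_mul, pow_two] at this
  exact this

theorem eY_eq (i : ℕ) : eY d n i =
    (d : Kf)⁻¹ • ∑ m ∈ Finset.range d, tY d n i ^ m * tY d n (i + 1) ^ (d - m) := by
  simp only [eY, eF, map_smul, map_sum, map_mul, map_pow, tY]

theorem fY_eq : fY d n = (d : Kf)⁻¹ • ∑ m ∈ Finset.range d, tY d n 1 ^ m := by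
  simp only [fY, fF, map_smul, map_sum, map_pow, tY]

theorem tY_commute_gY {i j : ℕ} (hi : 1 ≤ i) (hi' : i ≤ n - 1) (hj : 1 ≤ j) (hj' : j ≤ n)
    (h : j ≠ i) (h' : j ≠ i + 1) : Commute (tY d n j) (gY d n i) := by
  have := tY_mul_gY (d := d) hi hi' hj hj'
  rwa [sAct, if_neg h, if_neg h'] at this

theorem tY_pow_mul_gY {i : ℕ} (hi : 1 ≤ i) (hi' : i ≤ n - 1) (m : ℕ) :
    tY d n i ^ m * gY d n i = gY d n i * tY d n (i + 1) ^ m := by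
  have := tY_mul_gY (d := d) hi hi' hi (by omega)
  rw [sAct, if_pos rfl] at this
  exact (SemiconjBy.pow_right (a := gY d n i) this.symm m).symm

theorem tY_succ_pow_mul_gY {i : ℕ} (hi : 1 ≤ i) (hi' : i ≤ n - 1) (m : ℕ) :
    tY d n (i + 1) ^ m * gY d n i = gY d n i * tY d n i ^ m := by
  have := tY_mul_gY (d := d) hi hi' (j := i + 1) (by omega) (by omega)
  rw [sAct, if_neg (by omega), if_pos rfl] at this
  exact (SemiconjBy.pow_right (a := gY d n i) this.symm m).symm

theorem bbar_succ {k : ℕ} (hk : 1 ≤ k) :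
    bbar d n (k + 1) = gY d n k * bbar d n k * gY d n k := by
  obtain ⟨k, rfl⟩ := Nat.exists_eq_add_of_le' hk
  rfl

end Relations

section Spanning

open scoped Pointwise

variable (d n : ℕ)

/-- The generators of `Y_{d,n}^B` involving only the first `k` strands. -/
def strandGens (k : ℕ) : Set (YB d n) :=
  {x | (1 ≤ k ∧ x = bY d n) ∨ (∃ i, 1 ≤ i ∧ i < k ∧ x = gY d n i) ∨
    ∃ j, 1 ≤ j ∧ j ≤ k ∧ x = tY d n j}

/-- The subalgebra of `Y_{d,n}^B` generated by the generators on the first `k` strands. -/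
def strandAlg (k : ℕ) : Subalgebra Kf (YB d n) := Algebra.adjoin Kf (strandGens d n k)

/-- The space `H_k · span N_{k+1}`, where `H_k` is the algebra of the first `k` strands. -/
def strandMod (k : ℕ) : Submodule Kf (YB d n) :=
  Subalgebra.toSubmodule (strandAlg d n k) * Submodule.span Kf (Nset d n (k + 1))

/-- The elements that stabilize a submodule under right multiplication. -/
def rightStab {R A : Type*} [CommRing R] [Ring A] [Algebra R A] (M : Submodule R A) :
    Subalgebra R A where
  carrier := {a | ∀ x ∈ M, x * a ∈ M}
  mul_mem' ha hb x hx := by rw [← mul_assoc]; exact hb _ (ha x hx)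
  add_mem' ha hb x hx := by rw [mul_add]; exact M.add_mem (ha x hx) (hb x hx)
  algebraMap_mem' r x hx := by
    rw [← Algebra.commutes, ← Algebra.smul_def]; exact M.smul_mem r hx

variable {d n}

theorem bY_mem_strandAlg {k : ℕ} (hk : 1 ≤ k) : bY d n ∈ strandAlg d n k :=
  Algebra.subset_adjoin (Or.inl ⟨hk, rfl⟩)

theorem gY_mem_strandAlg {k i : ℕ} (hi : 1 ≤ i) (hi' : i < k) : gY d n i ∈ strandAlg d n k :=
  Algebra.subset_adjoin (Or.inr (Or.inl ⟨i, hi, hi', rfl⟩))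

theorem tY_mem_strandAlg {k j : ℕ} (hj : 1 ≤ j) (hj' : j ≤ k) : tY d n j ∈ strandAlg d n k :=
  Algebra.subset_adjoin (Or.inr (Or.inr ⟨j, hj, hj', rfl⟩))

theorem strandAlg_mono {k l : ℕ} (h : k ≤ l) : strandAlg d n k ≤ strandAlg d n l := by
  refine Algebra.adjoin_mono ?_
  rintro x (⟨h1, rfl⟩ | ⟨i, h1, h2, rfl⟩ | ⟨j, h1, h2, rfl⟩)
  · exact Or.inl ⟨by omega, rfl⟩
  · exact Or.inr (Or.inl ⟨i, h1, by omega, rfl⟩)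
  · exact Or.inr (Or.inr ⟨j, h1, by omega, rfl⟩)

theorem bbar_mem_strandAlg {k : ℕ} (hk : 1 ≤ k) : bbar d n k ∈ strandAlg d n k := by
  induction k, hk using Nat.le_induction with
  | base => exact bY_mem_strandAlg le_rfl
  | succ k hk ih =>
    rw [bbar_succ hk]
    exact mul_mem (mul_mem (gY_mem_strandAlg hk (by omega)) (strandAlg_mono (by omega) ih))
      (gY_mem_strandAlg hk (by omega))

theorem Nset_subset_strandAlg {k : ℕ} : Nset d n k ⊆ strandAlg d n k := by
  induction k with
  | zero => rintro x rfl; exact one_mem _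
  | succ k ih =>
    have ht := tY_mem_strandAlg (d := d) (n := n) (k := k + 1) (j := k + 1) (by omega) le_rfl
    have hb := bbar_mem_strandAlg (d := d) (n := n) (k := k + 1) (by omega)
    cases k with
    | zero =>
      rintro x ⟨m, -, rfl | rfl⟩
      · exact pow_mem ht m
      · exact mul_mem hb (pow_mem ht m)
    | succ k =>
      rintro x (⟨m, -, rfl | rfl⟩ | ⟨y, hy, rfl⟩)
      · exact pow_mem ht m
      · exact mul_mem hb (pow_mem ht m)
      · exact mul_mem (gY_mem_strandAlg (by omega) (by omega)) (strandAlg_mono (by omega) (ih hy))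

theorem commute_of_mem_strandAlg {k : ℕ} {x y : YB d n}
    (hb : 1 ≤ k → Commute x (bY d n)) (hg : ∀ i, 1 ≤ i → i < k → Commute x (gY d n i))
    (ht : ∀ j, 1 ≤ j → j ≤ k → Commute x (tY d n j)) (hy : y ∈ strandAlg d n k) :
    Commute x y := by
  have : strandAlg d n k ≤ Subalgebra.centralizer Kf {x} := by
    refine Algebra.adjoin_le ?_
    intro z hz
    rw [SetLike.mem_coe, Subalgebra.mem_centralizer_iff]
    rintro _ rfl
    rcases hz with ⟨h1, rfl⟩ | ⟨i, h1, h2, rfl⟩ | ⟨j, h1, h2, rfl⟩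
    · exact hb h1
    · exact hg i h1 h2
    · exact ht j h1 h2
  exact (Subalgebra.mem_centralizer_iff Kf).1 (this hy) x rfl

theorem gY_commute_of_mem {k : ℕ} (hk : k + 1 ≤ n - 1) {y : YB d n} (hy : y ∈ strandAlg d n k) :
    Commute (gY d n (k + 1)) y := by
  refine commute_of_mem_strandAlg (fun h => ?_) (fun i h1 h2 => ?_) (fun j h1 h2 => ?_) hy
  · exact (bY_commute_gY (by omega) hk).symm
  · exact gY_commute (by omega) hk h1 (by omega) (by omega)
  · exact (tY_commute_gY (by omega) hk h1 (by omega) (by omega) (by omega)).symm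

theorem tY_commute_of_mem {k : ℕ} (hk : k + 1 ≤ n) {y : YB d n} (hy : y ∈ strandAlg d n k) :
    Commute (tY d n (k + 1)) y := by
  refine commute_of_mem_strandAlg (fun h => ?_) (fun i h1 h2 => ?_) (fun j h1 h2 => ?_) hy
  · exact tY_commute_bY (by omega) hk
  · exact tY_commute_gY h1 (by omega) (by omega) (by omega) (by omega) (by omega)
  · exact tY_commute (by omega) hk h1 (by omega)

theorem bbar_commute_tY {k j : ℕ} (hk : 1 ≤ k) (hk' : k ≤ n) (hj : 1 ≤ j) (hj' : j ≤ n) :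
    Commute (bbar d n k) (tY d n j) := by
  induction k, hk using Nat.le_induction generalizing j with
  | base => exact (tY_commute_bY hj hj').symm
  | succ k hk ih =>
    have hs : sAct k j ≤ n ∧ 1 ≤ sAct k j := by unfold sAct; split_ifs <;> omega
    have hss : sAct k (sAct k j) = j := by unfold sAct; split_ifs <;> omega
    have h1 := tY_mul_gY (d := d) (i := k) hk (by omega) hj hj'
    have h2 := tY_mul_gY (d := d) (i := k) hk (by omega) hs.2 hs.1
    have h3 := ih (by omega) hs.2 hs.1
    rw [hss] at h2
    rw [bbar_succ hk]
    calc gY d n k * bbar d n k * gY d n k * tY d n j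
        = gY d n k * bbar d n k * (gY d n k * tY d n j) := by rw [mul_assoc]
      _ = gY d n k * (bbar d n k * tY d n (sAct k j)) * gY d n k := by rw [← h2]; noncomm_ring
      _ = (gY d n k * tY d n (sAct k j)) * bbar d n k * gY d n k := by
          rw [h3.eq]; noncomm_ring
      _ = tY d n j * (gY d n k * bbar d n k * gY d n k) := by rw [← h1]; noncomm_ring

theorem bbar_commute_of_mem {k : ℕ} (hk : k + 1 ≤ n) {y : YB d n} (hy : y ∈ strandAlg d n k) :
    Commute (bbar d n (k + 1)) y := by
  refine commute_of_mem_strandAlg (fun h => ?_) (fun i h1 h2 => ?_)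
    (fun j h1 h2 => bbar_commute_tY (by omega) hk h1 (by omega)) hy
  · clear hy
    induction k, h using Nat.le_induction with
    | base =>
      have := bY_gY_braid (d := d) (n := n)
      rw [bbar_succ le_rfl]
      change gY d n 1 * bY d n * gY d n 1 * bY d n = bY d n * (gY d n 1 * bY d n * gY d n 1)
      rw [← this]; noncomm_ring
    | succ k hk' ih =>
      rw [bbar_succ (by omega)]
      have h1 := (bY_commute_gY (d := d) (n := n) (i := k + 1) (by omega) (by omega)).symm
      exact (h1.mul_left (ih (by omega))).mul_left h1
  · clear hy
    have hk1 : 1 ≤ k := by omega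
    induction k, hk1 using Nat.le_induction with
    | base => omega
    | succ k hk' ih =>
      rw [bbar_succ (by omega)]
      rcases Nat.lt_or_ge i k with hik | hik
      · have h3 : Commute (gY d n (k + 1)) (gY d n i) :=
          gY_commute (by omega) (by omega) h1 (by omega) (by omega)
        exact (h3.mul_left (ih (by omega) hik)).mul_left h3
      · obtain rfl : i = k := by omega
        have hbr := gY_braid (d := d) (n := n) (i := i) h1 (by omega)
        have hc := gY_commute_of_mem (d := d) (n := n) (k := i) (by omega)
          (bbar_mem_strandAlg h1)
        have hl : ∀ x, gY d n i * (gY d n (i + 1) * (gY d n i * x)) =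
            gY d n (i + 1) * (gY d n i * (gY d n (i + 1) * x)) := fun x => by
          simp only [← mul_assoc, hbr]
        have hm : ∀ x, gY d n (i + 1) * (bbar d n i * x) = bbar d n i * (gY d n (i + 1) * x) :=
          fun x => by rw [← mul_assoc, hc.eq, mul_assoc]
        rw [mul_assoc] at hbr
        rw [bbar_succ h1, Commute, SemiconjBy]
        simp only [mul_assoc]
        rw [hbr, mul_assoc, ← hm, ← hl]

theorem tY_pow_mem_Nset (hd : 1 ≤ d) {k : ℕ} (hk : k + 1 ≤ n) (m : ℕ) :
    tY d n (k + 1) ^ m ∈ Nset d n (k + 1) := by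
  have hm : m % d ≤ d - 1 := by have := Nat.mod_lt m hd; omega
  have h : tY d n (k + 1) ^ m = tY d n (k + 1) ^ (m % d) :=
    pow_eq_pow_mod m (tY_pow_d (by omega) hk)
  rw [h]
  cases k with
  | zero => exact ⟨_, hm, Or.inl rfl⟩
  | succ k => exact Or.inl ⟨_, hm, Or.inl rfl⟩

theorem bbar_mul_tY_pow_mem_Nset (hd : 1 ≤ d) {k : ℕ} (hk : k + 1 ≤ n) (m : ℕ) :
    bbar d n (k + 1) * tY d n (k + 1) ^ m ∈ Nset d n (k + 1) := by
  have hm : m % d ≤ d - 1 := by have := Nat.mod_lt m hd; omega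
  have h : tY d n (k + 1) ^ m = tY d n (k + 1) ^ (m % d) :=
    pow_eq_pow_mod m (tY_pow_d (by omega) hk)
  rw [h]
  cases k with
  | zero => exact ⟨_, hm, Or.inr rfl⟩
  | succ k => exact Or.inl ⟨_, hm, Or.inr rfl⟩

theorem mul_mem_strandMod {k : ℕ} {h x : YB d n} (hh : h ∈ strandAlg d n k)
    (hx : x ∈ strandMod d n k) : h * x ∈ strandMod d n k := by
  refine Submodule.mul_induction_on hx (fun a ha b hb => ?_) (fun a b ha hb => ?_)
  · rw [← mul_assoc]
    exact Submodule.mul_mem_mul ((strandAlg d n k).mul_mem hh ha) hb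
  · rw [mul_add]; exact add_mem ha hb

theorem Nset_subset_strandMod {k : ℕ} {y : YB d n} (hy : y ∈ Nset d n (k + 1)) :
    y ∈ strandMod d n k := by
  have := Submodule.mul_mem_mul
    ((Subalgebra.mem_toSubmodule _).2 (one_mem (strandAlg d n k)))
    (Submodule.subset_span (R := Kf) hy)
  rwa [one_mul] at this

theorem mem_rightStab_strandMod {k : ℕ} {a : YB d n}
    (h : ∀ y ∈ Nset d n (k + 1), y * a ∈ strandMod d n k) :
    a ∈ rightStab (strandMod d n k) := by
  intro x hx
  refine Submodule.mul_induction_on hx (fun z hz y hy => ?_) (fun z w hz hw => ?_)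
  · rw [mul_assoc]
    refine mul_mem_strandMod hz ?_
    induction hy using Submodule.span_induction with
    | mem y hy => exact h y hy
    | zero => rw [zero_mul]; exact zero_mem _
    | add y z _ _ hy hz => rw [add_mul]; exact add_mem hy hz
    | smul r y _ hy => rw [smul_mul_assoc]; exact Submodule.smul_mem _ r hy
  · rw [add_mul]; exact add_mem hz hw

theorem gY_mul_mem_strandMod {k : ℕ} (hk : k + 1 ≤ n - 1) {x : YB d n}
    (hx : x ∈ strandMod d n k) : gY d n (k + 1) * x ∈ strandMod d n (k + 1) := by
  refine Submodule.mul_induction_on hx (fun z hz y hy => ?_) (fun z w hz hw => ?_)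
  · rw [← mul_assoc, (gY_commute_of_mem hk hz).eq, mul_assoc]
    refine mul_mem_strandMod (strandAlg_mono (by omega) hz) ?_
    induction hy using Submodule.span_induction with
    | mem y hy => exact Nset_subset_strandMod (Or.inr ⟨y, hy, rfl⟩)
    | zero => rw [mul_zero]; exact zero_mem _
    | add y z _ _ hy hz => rw [mul_add]; exact add_mem hy hz
    | smul r y _ hy => rw [mul_smul_comm]; exact Submodule.smul_mem _ r hy
  · rw [mul_add]; exact add_mem hz hw

theorem strandAlg_le_rightStab (hd : 1 ≤ d) {k : ℕ} (hk : k + 1 ≤ n) :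
    strandAlg d n (k + 1) ≤ rightStab (strandMod d n k) := by
  induction k with
  | zero =>
    have ht := fun m => Nset_subset_strandMod (tY_pow_mem_Nset hd hk m)
    have hbt := fun m => Nset_subset_strandMod (bbar_mul_tY_pow_mem_Nset hd hk m)
    refine Algebra.adjoin_le ?_
    rintro x (⟨-, rfl⟩ | ⟨i, h1, h2, rfl⟩ | ⟨j, h1, h2, rfl⟩)
    · have hc : ∀ m, tY d n 1 ^ m * bY d n = bY d n * tY d n 1 ^ m := fun m =>
        ((tY_commute_bY le_rfl hk).pow_left m).eq
      refine mem_rightStab_strandMod ?_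
      rintro y ⟨m, -, rfl | rfl⟩
      · rw [hc]; exact hbt m
      · rw [mul_assoc, hc, ← mul_assoc]
        change bY d n * bY d n * _ ∈ _
        rw [bY_mul_self, add_mul, one_mul, fY_eq]
        refine add_mem (ht m) ?_
        simp only [smul_mul_assoc, Finset.sum_mul]
        refine Submodule.smul_mem _ _ (Submodule.smul_mem _ _ (sum_mem fun l _ => ?_))
        rw [hc, mul_assoc, ← pow_add]
        exact hbt _
    · omega
    · obtain rfl : j = 1 := by omega
      refine mem_rightStab_strandMod ?_
      rintro y ⟨m, -, rfl | rfl⟩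
      · rw [← pow_succ]; exact ht _
      · rw [mul_assoc, ← pow_succ]; exact hbt _
  | succ k ih =>
    have hk' : k + 1 ≤ n - 1 := by omega
    have ht := fun m => Nset_subset_strandMod (tY_pow_mem_Nset hd hk m)
    have hbt := fun m => Nset_subset_strandMod (bbar_mul_tY_pow_mem_Nset hd hk m)
    have hH : ∀ h ∈ strandAlg d n (k + 1), h ∈ rightStab (strandMod d n (k + 1)) := by
      intro h hh
      have hct := tY_commute_of_mem hk hh
      refine mem_rightStab_strandMod ?_
      rintro y (⟨m, -, rfl | rfl⟩ | ⟨y, hy, rfl⟩)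
      · rw [(hct.pow_left m).eq]
        exact mul_mem_strandMod hh (ht m)
      · rw [((bbar_commute_of_mem hk hh).mul_left (hct.pow_left m)).eq]
        exact mul_mem_strandMod hh (hbt m)
      · rw [mul_assoc]
        exact gY_mul_mem_strandMod hk' (ih (by omega) hh _ (Nset_subset_strandMod hy))
    have htt : tY d n (k + 2) ∈ rightStab (strandMod d n (k + 1)) := by
      refine mem_rightStab_strandMod ?_
      rintro y (⟨m, -, rfl | rfl⟩ | ⟨y, hy, rfl⟩)
      · rw [← pow_succ]; exact ht _
      · rw [mul_assoc, ← pow_succ]; exact hbt _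
      · have h := tY_pow_mul_gY (d := d) (n := n) (i := k + 1) (by omega) hk' 1
        rw [pow_one, pow_one] at h
        rw [mul_assoc, ← (tY_commute_of_mem hk (Nset_subset_strandAlg hy)).eq, ← mul_assoc, ← h,
          mul_assoc]
        exact mul_mem_strandMod (tY_mem_strandAlg (by omega) le_rfl)
          (Nset_subset_strandMod (Or.inr ⟨y, hy, rfl⟩))
    have hgt : ∀ m, gY d n (k + 1) * tY d n (k + 1) ^ m ∈ strandMod d n (k + 1) := fun m =>
      gY_mul_mem_strandMod hk' (Nset_subset_strandMod (tY_pow_mem_Nset hd (by omega) m))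
    have hgg : gY d n (k + 1) ∈ rightStab (strandMod d n (k + 1)) := by
      have htk : tY d n (k + 1) ∈ rightStab (strandMod d n (k + 1)) :=
        hH _ (tY_mem_strandAlg (by omega) le_rfl)
      have hgg : ∀ m, tY d n (k + 1 + 1) ^ m * gY d n (k + 1) =
          gY d n (k + 1) * tY d n (k + 1) ^ m := tY_succ_pow_mul_gY (by omega) hk'
      have hgg' : ∀ m, tY d n (k + 1) ^ m * gY d n (k + 1) =
          gY d n (k + 1) * tY d n (k + 1 + 1) ^ m := tY_pow_mul_gY (by omega) hk'
      obtain ⟨e, he, hsq⟩ : ∃ e ∈ rightStab (strandMod d n (k + 1)),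
          gY d n (k + 1) * gY d n (k + 1) = 1 + (uu - uu⁻¹) • (gY d n (k + 1) * e) := by
        refine ⟨(d : Kf)⁻¹ • ∑ m ∈ Finset.range d,
          tY d n (k + 1 + 1) ^ m * tY d n (k + 1) ^ (d - m),
          Subalgebra.smul_mem _ (sum_mem fun m _ => mul_mem (pow_mem htt _) (pow_mem htk _)) _, ?_⟩
        rw [gY_mul_self (by omega) hk', eY_eq]
        simp only [smul_mul_assoc, mul_smul_comm, Finset.sum_mul, Finset.mul_sum]
        refine congrArg (fun z => 1 + (uu - uu⁻¹) • (d : Kf)⁻¹ • z)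
          (Finset.sum_congr rfl fun m _ => ?_)
        rw [mul_assoc, hgg, ← mul_assoc, hgg', mul_assoc]
      refine mem_rightStab_strandMod ?_
      rintro y (⟨m, -, rfl | rfl⟩ | ⟨y, hy, rfl⟩)
      · rw [hgg]; exact hgt m
      · have h : bbar d n (k + 2) * tY d n (k + 2) ^ m * gY d n (k + 1) =
            gY d n (k + 1) * (bbar d n (k + 1) * tY d n (k + 1) ^ m) +
              (uu - uu⁻¹) • (bbar d n (k + 2) * tY d n (k + 2) ^ 0 * e * tY d n (k + 1) ^ m) := by
          rw [mul_assoc, hgg, bbar_succ (by omega), mul_assoc, ← mul_assoc (gY d n (k + 1))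
            (gY d n (k + 1)), hsq]
          simp only [add_mul, mul_add, one_mul, smul_mul_assoc, mul_smul_comm, mul_assoc, pow_zero]
        rw [h]
        exact add_mem (gY_mul_mem_strandMod hk'
            (Nset_subset_strandMod (bbar_mul_tY_pow_mem_Nset hd (by omega) m)))
          (Submodule.smul_mem _ _ (pow_mem htk m _ (he _ (hbt 0))))
      · have h1 : ∀ m, gY d n (k + 1) * tY d n (k + 1) ^ m * gY d n (k + 1) ∈
            strandMod d n (k + 1) := by
          intro m
          have h : gY d n (k + 1) * tY d n (k + 1) ^ m * gY d n (k + 1) = tY d n (k + 2) ^ m +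
              (uu - uu⁻¹) • (gY d n (k + 1) * tY d n (k + 1) ^ 0 * e * tY d n (k + 2) ^ m) := by
            rw [mul_assoc, hgg', ← mul_assoc, hsq]
            simp only [add_mul, one_mul, smul_mul_assoc, mul_assoc, pow_zero]
          rw [h]
          exact add_mem (ht m) (Submodule.smul_mem _ _ (pow_mem htt m _ (he _ (hgt 0))))
        have h2 : ∀ m, gY d n (k + 1) * (bbar d n (k + 1) * tY d n (k + 1) ^ m) * gY d n (k + 1) ∈
            strandMod d n (k + 1) := by
          intro m
          have h := hbt m
          rw [bbar_succ (by omega), mul_assoc, ← hgg', ← mul_assoc, mul_assoc (gY d n (k + 1))] at h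
          exact h
        cases k with
        | zero =>
          obtain ⟨m, -, rfl | rfl⟩ := hy
          · exact h1 m
          · exact h2 m
        | succ k =>
          obtain ⟨m, -, rfl | rfl⟩ | ⟨z, hz, rfl⟩ := hy
          · exact h1 m
          · exact h2 m
          · have hc := gY_commute_of_mem hk' (strandAlg_mono (d := d) (k := k + 1) (by omega)
              (Nset_subset_strandAlg hz))
            have hbr := gY_braid (d := d) (n := n) (i := k + 1) (by omega) (by omega)
            have h : gY d n (k + 1 + 1) * (gY d n (k + 1) * z) * gY d n (k + 1 + 1) =
                gY d n (k + 1) * (gY d n (k + 1 + 1) * (gY d n (k + 1) * z)) := by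
              rw [mul_assoc, mul_assoc, ← hc.eq]
              simp only [← mul_assoc, hbr]
            rw [h]
            exact mul_mem_strandMod (gY_mem_strandAlg (by omega) (by omega))
              (Nset_subset_strandMod (Or.inr ⟨_, Or.inr ⟨z, hz, rfl⟩, rfl⟩))
    refine Algebra.adjoin_le ?_
    rintro x (⟨-, rfl⟩ | ⟨i, h1, h2, rfl⟩ | ⟨j, h1, h2, rfl⟩)
    · exact hH _ (bY_mem_strandAlg (by omega))
    · rcases Nat.lt_or_ge i (k + 1) with h | h
      · exact hH _ (gY_mem_strandAlg h1 h)
      · obtain rfl : i = k + 1 := by omega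
        exact hgg
    · rcases Nat.lt_or_ge j (k + 2) with h | h
      · exact hH _ (tY_mem_strandAlg h1 (by omega))
      · obtain rfl : j = k + 2 := by omega
        exact htt

theorem strandAlg_succ_le (hd : 1 ≤ d) {k : ℕ} (hk : k + 1 ≤ n) :
    Subalgebra.toSubmodule (strandAlg d n (k + 1)) ≤ strandMod d n k := by
  intro x hx
  have h1 := Nset_subset_strandMod (tY_pow_mem_Nset (d := d) hd hk 0)
  rw [pow_zero] at h1
  have := strandAlg_le_rightStab hd hk hx _ h1
  rwa [one_mul] at this

variable (d n) in
/-- The set of products `𝔫_1 ⋯ 𝔫_k` with `𝔫_i ∈ N_{d,i}`. -/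
def Dprefix (k : ℕ) : Set (YB d n) :=
  {x | ∃ f : Fin k → YB d n, (∀ i : Fin k, f i ∈ Nset d n (i.val + 1)) ∧
    x = (List.ofFn f).prod}

theorem Dprefix_zero : Dprefix d n 0 = {1} := by
  ext x
  simp [Dprefix]

theorem Dprefix_succ (k : ℕ) :
    Dprefix d n (k + 1) = Set.image2 (· * ·) (Dprefix d n k) (Nset d n (k + 1)) := by
  ext x
  constructor
  · rintro ⟨f, hf, rfl⟩
    refine ⟨_, ⟨fun i => f i.castSucc, fun i => hf i.castSucc, rfl⟩, f (Fin.last k),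
      hf (Fin.last k), ?_⟩
    simp [List.ofFn_succ', -List.ofFn_succ]
  · rintro ⟨_, ⟨f, hf, rfl⟩, y, hy, rfl⟩
    refine ⟨Fin.snoc f y, fun i => ?_, ?_⟩
    · refine Fin.lastCases ?_ (fun i => ?_) i
      · simpa using hy
      · simpa using hf i
    · simp [List.ofFn_succ', -List.ofFn_succ]

theorem strandAlg_le_span_Dprefix (hd : 1 ≤ d) {k : ℕ} (hk : k ≤ n) :
    Subalgebra.toSubmodule (strandAlg d n k) ≤ Submodule.span Kf (Dprefix d n k) := by
  induction k with
  | zero =>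
    have : strandGens d n 0 = ∅ := by
      ext x
      simp only [strandGens, Set.mem_ofPred_eq, Set.mem_empty_iff_false, iff_false]
      rintro (⟨h, -⟩ | ⟨i, -, h, -⟩ | ⟨j, h, h', -⟩) <;> omega
    rw [Dprefix_zero, strandAlg, this, Algebra.adjoin_empty, Algebra.toSubmodule_bot,
      Submodule.one_eq_span]
  | succ k ih =>
    refine (strandAlg_succ_le hd hk).trans ?_
    rw [Dprefix_succ, Set.image2_mul, ← Submodule.span_mul_span]
    exact mul_le_mul' (ih (by omega)) le_rfl

theorem strandAlg_eq_top (hn : 2 ≤ n) : strandAlg d n n = ⊤ := by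
  let φ : FA n →ₐ[Kf] strandAlg d n n := FreeAlgebra.lift Kf fun
    | Gen.b => ⟨bY d n, bY_mem_strandAlg (by omega)⟩
    | Gen.g i => ⟨gY d n (i + 1), gY_mem_strandAlg (by omega) (by omega)⟩
    | Gen.t j => ⟨tY d n (j + 1), tY_mem_strandAlg (by omega) (by omega)⟩
  have h : (strandAlg d n n).val.comp φ = mkY d n := by
    ext x
    cases x with
    | b => simp [φ, bY, Bb]
    | g i =>
      have : (i : ℕ) + 1 ≤ n - 1 := i.2
      simp [φ, gY, Gg]
    | t j => simp [φ, tY, Tt]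
  rw [eq_top_iff]
  rintro x -
  obtain ⟨y, rfl⟩ := RingQuot.mkAlgHom_surjective Kf (YBrel d n) x
  change mkY d n y ∈ _
  rw [← h]
  exact Subtype.property _

theorem span_Dset (hd : 1 ≤ d) (hn : 2 ≤ n) : Submodule.span Kf (Dset d n) = ⊤ := by
  have := strandAlg_le_span_Dprefix (n := n) hd le_rfl
  rw [strandAlg_eq_top hn] at this
  exact top_le_iff.1 this

theorem Nset_finite_ncard_le (hd : 1 ≤ d) (k : ℕ) :
    (Nset d n (k + 1)).Finite ∧ (Nset d n (k + 1)).ncard ≤ 2 * d * (k + 1) := by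
  have key : ∀ k, {x | ∃ m ≤ d - 1, x = tY d n k ^ m ∨ x = bbar d n k * tY d n k ^ m} =
      (fun m => tY d n k ^ m) '' (Finset.range d : Set ℕ) ∪
      (fun m => bbar d n k * tY d n k ^ m) '' (Finset.range d : Set ℕ) := by
    intro k
    have hm : ∀ m, m ≤ d - 1 ↔ m < d := by omega
    ext x
    simp only [Set.mem_ofPred_eq, Set.mem_union, Set.mem_image, Finset.coe_range, Set.mem_Iio, hm]
    constructor
    · rintro ⟨m, h, rfl | rfl⟩
      · exact Or.inl ⟨m, h, rfl⟩
      · exact Or.inr ⟨m, h, rfl⟩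
    · rintro (⟨m, h, rfl⟩ | ⟨m, h, rfl⟩)
      · exact ⟨m, h, Or.inl rfl⟩
      · exact ⟨m, h, Or.inr rfl⟩
  have hfin : ∀ k, {x | ∃ m ≤ d - 1, x = tY d n k ^ m ∨
      x = bbar d n k * tY d n k ^ m}.Finite := by
    intro k
    rw [key]
    exact ((Finset.finite_toSet _).image _).union ((Finset.finite_toSet _).image _)
  have hcard : ∀ k, {x | ∃ m ≤ d - 1, x = tY d n k ^ m ∨
      x = bbar d n k * tY d n k ^ m}.ncard ≤ 2 * d := by
    intro k
    rw [key]
    refine (Set.ncard_union_le _ _).trans ?_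
    have h1 := Set.ncard_image_le (f := fun m => tY d n k ^ m)
      (Finset.finite_toSet (Finset.range d))
    have h2 := Set.ncard_image_le (f := fun m => bbar d n k * tY d n k ^ m)
      (Finset.finite_toSet (Finset.range d))
    rw [Set.ncard_coe_finset, Finset.card_range] at h1 h2
    omega
  induction k with
  | zero => exact ⟨hfin 1, (hcard 1).trans (by omega)⟩
  | succ k ih =>
    have h : Nset d n (k + 1 + 1) = {x | ∃ m ≤ d - 1, x = tY d n (k + 2) ^ m ∨
        x = bbar d n (k + 2) * tY d n (k + 2) ^ m} ∪
        (fun y => gY d n (k + 1) * y) '' Nset d n (k + 1) := by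
      ext x
      simp only [Nset, Set.mem_ofPred_eq, Set.mem_union, Set.mem_image, eq_comm]
    rw [h]
    refine ⟨(hfin _).union (ih.1.image _), (Set.ncard_union_le _ _).trans ?_⟩
    have h1 := Set.ncard_image_le (f := fun y => gY d n (k + 1) * y) ih.1
    have h2 := hcard (k + 2)
    calc _ ≤ 2 * d + 2 * d * (k + 1) := add_le_add h2 (h1.trans ih.2)
      _ = _ := by ring

theorem Dprefix_finite_ncard_le (hd : 1 ≤ d) (k : ℕ) :
    (Dprefix d n k).Finite ∧ (Dprefix d n k).ncard ≤ 2 ^ k * d ^ k * k.factorial := by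
  induction k with
  | zero => rw [Dprefix_zero]; simp
  | succ k ih =>
    have hN := Nset_finite_ncard_le (n := n) hd k
    rw [Dprefix_succ]
    refine ⟨ih.1.image2 _ hN.1, ?_⟩
    rw [← Set.image_uncurry_prod]
    refine (Set.ncard_image_le (ih.1.prod hN.1)).trans ?_
    rw [Set.ncard_prod]
    calc _ ≤ (2 ^ k * d ^ k * k.factorial) * (2 * d * (k + 1)) := Nat.mul_le_mul ih.2 hN.2
      _ = _ := by rw [Nat.factorial_succ]; ring

end Spanning

section LocalOperators

variable {K S : Type*} [Field K] [DecidableEq S]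

/-- The action of `g_i` on functions of two adjacent letters. -/
def rMat (q : K) (F : ℤ × S → ℤ × S → K) (p r : ℤ × S) : K :=
  if p = r then q * F p r
  else if p.2 = r.2 ∧ r.1 < p.1 then F r p + (q - q⁻¹) * F p r
  else F r p

/-- The action of `b_1` on functions of the first letter; `e` is the trivial colour. -/
def kMat (v : K) (e : S) (F : ℤ × S → K) (p : ℤ × S) : K :=
  if p = (0, e) then v * F p
  else if p.2 = e ∧ p.1 < 0 then F (-p.1, p.2) + (v - v⁻¹) * F p
  else F (-p.1, p.2)

theorem rMat_rMat {q : K} (hq : q ≠ 0) (F : ℤ × S → ℤ × S → K) (p r : ℤ × S) :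
    rMat q (rMat q F) p r = F p r + (q - q⁻¹) * if p.2 = r.2 then rMat q F p r else 0 := by
  obtain ⟨a, α⟩ := p
  obtain ⟨b, β⟩ := r
  have hq' : q * q⁻¹ = 1 := mul_inv_cancel₀ hq
  by_cases h1 : α = β
  · subst h1
    rcases lt_trichotomy a b with h | rfl | h
    · simp [rMat, h.ne, h.ne', h, h.not_gt]
    · simp [rMat]; linear_combination F (a,α) (a,α) * hq'
    · simp [rMat, h.ne, h.ne', h, h.not_gt]
  · simp [rMat, h1, Ne.symm h1]

theorem kMat_kMat {v : K} (hv : v ≠ 0) (e : S) (F : ℤ × S → K) (p : ℤ × S) :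
    kMat v e (kMat v e F) p = F p + (v - v⁻¹) * if p.2 = e then kMat v e F p else 0 := by
  obtain ⟨a, α⟩ := p
  have hv' : v * v⁻¹ = 1 := mul_inv_cancel₀ hv
  by_cases h1 : α = e
  · subst h1
    rcases lt_trichotomy a 0 with h | rfl | h
    · simp [kMat, h.ne, h, h.not_gt]
    · simp [kMat]; linear_combination F (0,α) * hv'
    · simp [kMat, h.ne', h, h.not_gt]
  · simp [kMat, h1]

theorem rMat_braid {q : K} (hq : q ≠ 0) (F : ℤ × S → ℤ × S → ℤ × S → K) (p r s : ℤ × S) :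
    rMat q (fun p r => rMat q (fun r s => rMat q (fun p r => F p r s) p r) r s) p r =
    rMat q (fun r s => rMat q (fun p r => rMat q (fun r s => F p r s) r s) p r) r s := by
  obtain ⟨a, α⟩ := p
  obtain ⟨b, β⟩ := r
  obtain ⟨c, γ⟩ := s
  have hq' : q * q⁻¹ = 1 := mul_inv_cancel₀ hq
  by_cases h1 : α = β <;> by_cases h2 : β = γ <;> by_cases h3 : α = γ <;>
    try (subst_vars; contradiction)
  all_goals
    rcases lt_trichotomy a b with h4 | h4 | h4 <;> rcases lt_trichotomy b c with h5 | h5 | h5 <;>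
    rcases lt_trichotomy a c with h6 | h6 | h6 <;> try omega
  all_goals
    subst_vars
    simp only [rMat, Prod.mk.injEq, ne_of_lt, ne_of_gt, not_lt_of_gt, lt_irrefl, *,
      if_true, if_false, and_true, true_and, and_false, false_and, and_self]
    try first | ring1 | (field_simp; ring1)

set_option maxHeartbeats 1000000 in
theorem kMat_rMat_braid {q v : K} (hq : q ≠ 0) (hv : v ≠ 0) (e : S) (F : ℤ × S → ℤ × S → K)
    (p r : ℤ × S) :
    kMat v e (fun p => rMat q (fun p r => kMat v e (fun p => rMat q F p r) p) p r) p =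
    rMat q (fun p r => kMat v e (fun p => rMat q (fun p r => kMat v e (fun p => F p r) p) p r) p)
      p r := by
  obtain ⟨a, α⟩ := p
  obtain ⟨b, β⟩ := r
  have hq' : q * q⁻¹ = 1 := mul_inv_cancel₀ hq
  have hv' : v * v⁻¹ = 1 := mul_inv_cancel₀ hv
  have i1 : -a = -b ↔ a = b := by omega
  have i2 : -a = b ↔ a = -b := by omega
  by_cases h1 : α = β <;> by_cases h2 : β = e <;> by_cases h3 : α = e <;>
    try (subst_vars; contradiction)
  all_goals
    have g1 : b < -a ↔ a < -b := by omega
    have g2 : -a < b ↔ -b < a := by omega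
    have g3 : -a < -b ↔ b < a := by omega
    have g4 : -b < -a ↔ a < b := by omega
    have g5 : -b = a ↔ a = -b := by omega
    have g6 : b = -a ↔ a = -b := by omega
    rcases lt_trichotomy a b with h4 | h4 | h4 <;> rcases lt_trichotomy a (-b) with h5 | h5 | h5 <;>
    rcases lt_trichotomy a 0 with h6 | h6 | h6 <;> rcases lt_trichotomy b 0 with h7 | h7 | h7 <;>
    try omega
  all_goals
    try subst h1
    try subst h2
    try subst h3
    try have h8 := Ne.symm h1
    try have h8 := Ne.symm h2
    try have h8 := Ne.symm h3
    simp only [rMat, kMat, Prod.mk.injEq, ne_of_lt, ne_of_gt, not_lt_of_gt, lt_irrefl,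
      if_true, if_false, and_true, and_false, and_self, neg_neg, neg_zero, Left.neg_neg_iff,
      Left.neg_pos_iff, neg_lt_self_iff, lt_neg_self_iff, *]
    try first | ring1 | (field_simp; ring1)

end LocalOperators

section Representation

open scoped Classical
open Function

variable (d : ℕ)

/-- Words of signed letters coloured by `d`-th roots of unity; only positions `1, …, n` matter. -/
abbrev Word : Type := ℕ → ℤ × rootsOfUnity d Kf

variable {d}

/-- The operator representing `g_i` on functions on words. -/
def gOp (i : ℕ) : Module.End Kf (Word d → Kf) where
  toFun f x := rMat uu (fun p r => f (update (update x i p) (i + 1) r)) (x i) (x (i + 1))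
  map_add' f g := by
    ext x; simp only [rMat, Pi.add_apply]; split_ifs <;> ring
  map_smul' c f := by
    ext x; simp only [rMat, Pi.smul_apply, smul_eq_mul, RingHom.id_apply]; split_ifs <;> ring

/-- The operator representing `b_1` on functions on words. -/
def bOp : Module.End Kf (Word d → Kf) where
  toFun f x := kMat vv 1 (fun p => f (update x 1 p)) (x 1)
  map_add' f g := by
    ext x; simp only [kMat, Pi.add_apply]; split_ifs <;> ring
  map_smul' c f := by
    ext x; simp only [kMat, Pi.smul_apply, smul_eq_mul, RingHom.id_apply]; split_ifs <;> ring

/-- The value in `Kf` of the colour of the `j`-th letter of a word. -/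
def colour (x : Word d) (j : ℕ) : Kf := (((x j).2 : Kfˣ) : Kf)

/-- The operator representing `t_j` on functions on words. -/
def tOp (j : ℕ) : Module.End Kf (Word d → Kf) where
  toFun f x := colour x j * f x
  map_add' f g := by ext x; simp only [Pi.add_apply]; ring
  map_smul' c f := by ext x; simp only [Pi.smul_apply, smul_eq_mul, RingHom.id_apply]; ring

theorem gOp_apply (i : ℕ) (f : Word d → Kf) (x : Word d) : gOp i f x =
    rMat uu (fun p r => f (update (update x i p) (i + 1) r)) (x i) (x (i + 1)) := rfl

theorem bOp_apply (f : Word d → Kf) (x : Word d) :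
    bOp f x = kMat vv 1 (fun p => f (update x 1 p)) (x 1) := rfl

theorem tOp_apply (j : ℕ) (f : Word d → Kf) (x : Word d) : tOp j f x = colour x j * f x := rfl

theorem tOp_pow_apply (j m : ℕ) (f : Word d → Kf) (x : Word d) :
    (tOp j ^ m) f x = colour x j ^ m * f x := by
  induction m with
  | zero => simp
  | succ m ih => rw [pow_succ', Module.End.mul_apply, tOp_apply, ih, pow_succ]; ring

theorem colour_pow (x : Word d) (j : ℕ) : colour x j ^ d = 1 := by
  have := (x j).2.2
  rw [mem_rootsOfUnity] at this
  simpa [colour] using congrArg (Units.val) this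

theorem colour_eq_iff (x : Word d) (i j : ℕ) : colour x i = colour x j ↔ (x i).2 = (x j).2 := by
  simp [colour, Units.val_inj]

theorem uu_ne_zero : uu ≠ 0 := by
  simp [uu]

theorem vv_ne_zero : vv ≠ 0 := by
  simp [vv]

theorem average_pow (hd : 1 ≤ d) {z : Kf} (hz : z ^ d = 1) :
    (d : Kf)⁻¹ * ∑ m ∈ Finset.range d, z ^ m = if z = 1 then 1 else 0 := by
  split_ifs with h
  · subst h
    have : (d : Kf) ≠ 0 := by exact_mod_cast (by omega : d ≠ 0)
    simp [this]
  · rw [geom_sum_eq h, hz, sub_self, zero_div, mul_zero]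

theorem average_div (hd : 1 ≤ d) {y z : Kf} (hy : y ^ d = 1) (hz : z ^ d = 1) :
    (d : Kf)⁻¹ * ∑ m ∈ Finset.range d, y ^ m * z ^ (d - m) = if y = z then 1 else 0 := by
  have hz0 : z ≠ 0 := by rintro rfl; rw [zero_pow (by omega)] at hz; exact zero_ne_one hz
  have h := average_pow hd (z := y / z) (by rw [div_pow, hy, hz, div_one])
  simp only [div_eq_one_iff_eq hz0] at h
  rw [← h]
  refine congrArg _ (Finset.sum_congr rfl fun m hm => ?_)
  rw [pow_sub₀ _ hz0 (Finset.mem_range.1 hm).le, hz, one_mul, div_pow, div_eq_mul_inv]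

theorem tOp_commute (i j : ℕ) : tOp (d := d) i * tOp j = tOp j * tOp i := by
  ext f x
  simp only [Module.End.mul_apply, tOp_apply]
  ring

theorem tOp_mul_gOp (i j : ℕ) : tOp (d := d) j * gOp i = gOp i * tOp (sAct i j) := by
  ext f x
  simp only [Module.End.mul_apply, tOp_apply, gOp_apply, rMat, colour, sAct]
  by_cases h1 : j = i
  · subst h1
    simp only [if_true, update_self]
    split_ifs with h2 h3
    · simp only [h2]; ring
    · simp only [h3.1]; ring
    · rfl
  · by_cases h2 : j = i + 1
    · subst h2
      simp only [if_neg h1, if_true, update_self, ne_eq, Nat.left_eq_add, one_ne_zero,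
        not_false_eq_true, update_of_ne]
      split_ifs with h2 h3
      · simp only [h2]; ring
      · simp only [h3.1]; ring
      · rfl
    · simp only [if_neg h1, if_neg h2, update_of_ne h1, update_of_ne h2]
      split_ifs <;> ring

theorem tOp_mul_bOp (j : ℕ) : tOp (d := d) j * bOp = bOp * tOp j := by
  ext f x
  simp only [Module.End.mul_apply, tOp_apply, bOp_apply, kMat, colour]
  by_cases h1 : j = 1
  · subst h1
    simp only [update_self]
    split_ifs <;> ring
  · simp only [update_of_ne h1]
    split_ifs <;> ring

theorem gOp_update (x : Word d) (i : ℕ) (p r : ℤ × rootsOfUnity d Kf) (f : Word d → Kf) :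
    gOp i f (update (update x i p) (i + 1) r) =
      rMat uu (fun p r => f (update (update x i p) (i + 1) r)) p r := by
  have h : ∀ p' r', update (update (update (update x i p) (i + 1) r) i p') (i + 1) r' =
      update (update x i p') (i + 1) r' := by
    intro p' r'
    ext1 j
    simp only [update_apply]
    grind
  simp only [gOp_apply, h]
  simp

theorem bOp_update (x : Word d) (p : ℤ × rootsOfUnity d Kf) (f : Word d → Kf) :
    bOp f (update x 1 p) = kMat vv 1 (fun p => f (update x 1 p)) p := by
  simp only [bOp_apply, update_idem, update_self]

theorem gOp_sq (i : ℕ) (hd : 1 ≤ d) : gOp (d := d) i ^ 2 = 1 + (uu - uu⁻¹) •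
    (((d : Kf)⁻¹ • ∑ m ∈ Finset.range d, tOp i ^ m * tOp (i + 1) ^ (d - m)) * gOp i) := by
  ext f x
  have h := average_div hd (colour_pow x i) (colour_pow x (i + 1))
  have h2 := rMat_rMat uu_ne_zero (fun p r => f (update (update x i p) (i + 1) r)) (x i) (x (i + 1))
  have h3 : (gOp i ^ 2) f x = rMat uu (rMat uu fun p r => f (update (update x i p) (i + 1) r))
      (x i) (x (i + 1)) := by
    rw [pow_two, Module.End.mul_apply, gOp_apply]
    simp only [gOp_update]
  simp only [LinearMap.add_apply, Module.End.one_apply, LinearMap.smul_apply, Module.End.mul_apply,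
    LinearMap.sum_apply, Pi.add_apply, Pi.smul_apply, Finset.sum_apply, tOp_pow_apply, smul_eq_mul]
  rw [h3, h2, ← gOp_apply]
  simp only [update_eq_self, ← mul_assoc]
  rw [← Finset.sum_mul, ← mul_assoc, mul_assoc (uu - uu⁻¹), h]
  simp only [colour_eq_iff]
  split_ifs <;> simp

theorem bOp_sq (hd : 1 ≤ d) : bOp (d := d) ^ 2 = 1 + (vv - vv⁻¹) •
    (((d : Kf)⁻¹ • ∑ m ∈ Finset.range d, tOp 1 ^ m) * bOp) := by
  ext f x
  have h := average_pow hd (colour_pow x 1)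
  have h2 := kMat_kMat vv_ne_zero 1 (fun p => f (update x 1 p)) (x 1)
  have h3 : (bOp ^ 2) f x = kMat vv 1 (kMat vv 1 fun p => f (update x 1 p)) (x 1) := by
    rw [pow_two, Module.End.mul_apply, bOp_apply]
    simp only [bOp_update]
  have h4 : colour x 1 = 1 ↔ (x 1).2 = 1 := by simp [colour]
  simp only [LinearMap.add_apply, Module.End.one_apply, LinearMap.smul_apply, Module.End.mul_apply,
    LinearMap.sum_apply, Pi.add_apply, Pi.smul_apply, Finset.sum_apply, tOp_pow_apply, smul_eq_mul]
  rw [h3, h2, ← bOp_apply]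
  simp only [update_eq_self]
  rw [← Finset.sum_mul, ← mul_assoc (d : Kf)⁻¹, h]
  simp only [h4]
  split_ifs <;> simp

/-- The word `x` with the letters at positions `i, i + 1, i + 2` replaced. -/
def replaceThree (x : Word d) (i : ℕ) (p r s : ℤ × rootsOfUnity d Kf) : Word d :=
  update (update (update x i p) (i + 1) r) (i + 2) s

theorem gOp_replaceThree (x : Word d) (i : ℕ) (p r s : ℤ × rootsOfUnity d Kf) (f : Word d → Kf) :
    gOp i f (replaceThree x i p r s) = rMat uu (fun p r => f (replaceThree x i p r s)) p r := by
  have h : ∀ p' r', update (update (replaceThree x i p r s) i p') (i + 1) r' =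
      replaceThree x i p' r' s := by
    intro p' r'
    ext1 j
    simp only [replaceThree, update_apply]
    grind
  simp only [gOp_apply, h]
  simp [replaceThree]

theorem gOp_succ_replaceThree (x : Word d) (i : ℕ) (p r s : ℤ × rootsOfUnity d Kf)
    (f : Word d → Kf) : gOp (i + 1) f (replaceThree x i p r s) =
      rMat uu (fun r s => f (replaceThree x i p r s)) r s := by
  have h : ∀ p' r', update (update (replaceThree x i p r s) (i + 1) p') (i + 1 + 1) r' =
      replaceThree x i p p' r' := by
    intro p' r'
    ext1 j
    simp only [replaceThree, update_apply]
    grind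
  simp only [gOp_apply, h]
  simp [replaceThree]

theorem gOp_braid (i : ℕ) : gOp (d := d) i * gOp (i + 1) * gOp i =
    gOp (i + 1) * gOp i * gOp (i + 1) := by
  ext f x
  have hx : x = replaceThree x i (x i) (x (i + 1)) (x (i + 2)) := by
    ext1 j
    simp only [replaceThree, update_apply]
    grind
  rw [hx]
  simp only [Module.End.mul_apply, gOp_replaceThree, gOp_succ_replaceThree]
  exact rMat_braid uu_ne_zero (fun p r s => f (replaceThree x i p r s)) _ _ _

theorem gOp_commute {i j : ℕ} (h : i + 1 < j) : gOp (d := d) i * gOp j = gOp j * gOp i := by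
  ext f x
  have h1 : ∀ p r, update (update x i p) (i + 1) r j = x j := fun p r => by
    simp only [update_apply]; grind
  have h2 : ∀ p r, update (update x i p) (i + 1) r (j + 1) = x (j + 1) := fun p r => by
    simp only [update_apply]; grind
  have h3 : ∀ p r, update (update x j p) (j + 1) r i = x i := fun p r => by
    simp only [update_apply]; grind
  have h4 : ∀ p r, update (update x j p) (j + 1) r (i + 1) = x (i + 1) := fun p r => by
    simp only [update_apply]; grind
  have h5 : ∀ p r s w, update (update (update (update x j s) (j + 1) w) i p) (i + 1) r =
      update (update (update (update x i p) (i + 1) r) j s) (j + 1) w := fun p r s w => by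
    ext1 k; simp only [update_apply]; grind
  simp only [Module.End.mul_apply, gOp_apply, h1, h2, h3, h4, h5, rMat]
  split_ifs <;> ring

theorem bOp_commute_gOp {i : ℕ} (h : 2 ≤ i) : bOp (d := d) * gOp i = gOp i * bOp := by
  ext f x
  have h1 : ∀ p r, update (update x i p) (i + 1) r 1 = x 1 := fun p r => by
    simp only [update_apply]; grind
  have h2 : ∀ p, update x 1 p i = x i := fun p => by
    simp only [update_apply]; grind
  have h3 : ∀ p, update x 1 p (i + 1) = x (i + 1) := fun p => by
    simp only [update_apply]; grind
  have h5 : ∀ p r s, update (update (update x i p) (i + 1) r) 1 s =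
      update (update (update x 1 s) i p) (i + 1) r := fun p r s => by
    ext1 k; simp only [update_apply]; grind
  simp only [Module.End.mul_apply, gOp_apply, bOp_apply, h1, h2, h3, h5, rMat, kMat]
  split_ifs <;> ring

theorem bOp_gOp_braid : bOp (d := d) * gOp 1 * bOp * gOp 1 = gOp 1 * bOp * gOp 1 * bOp := by
  ext f x
  have hg : ∀ (f : Word d → Kf) p r, gOp 1 f (update (update x 1 p) 2 r) =
      rMat uu (fun p r => f (update (update x 1 p) 2 r)) p r :=
    fun f p r => gOp_update x 1 p r f
  have hb : ∀ (f : Word d → Kf) p r, bOp f (update (update x 1 p) 2 r) =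
      kMat vv 1 (fun p => f (update (update x 1 p) 2 r)) p := by
    intro f p r
    have h : ∀ p', update (update (update x 1 p) 2 r) 1 p' = update (update x 1 p') 2 r := by
      intro p'
      ext1 j
      simp only [update_apply]
      grind
    simp only [bOp_apply, h]
    simp
  have hx : x = update (update x 1 (x 1)) 2 (x 2) := by
    simp
  rw [hx]
  simp only [Module.End.mul_apply, hg, hb]
  exact kMat_rMat_braid uu_ne_zero vv_ne_zero _ (fun p r => f (update (update x 1 p) 2 r)) _ _

variable {n : ℕ}

/-- The operators representing the generators of `Y_{d,n}^B`. -/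
def genOp : Gen n → Module.End Kf (Word d → Kf)
  | Gen.b => bOp
  | Gen.g i => gOp (i + 1)
  | Gen.t j => tOp (j + 1)

variable (d n) in
/-- The representation of the free algebra given by `genOp`. -/
def freeRep : FA n →ₐ[Kf] Module.End Kf (Word d → Kf) := FreeAlgebra.lift Kf genOp

theorem freeRep_Bb : freeRep d n (Bb n) = bOp := by
  simp [freeRep, Bb, genOp]

theorem freeRep_Gg {i : ℕ} (hi : 1 ≤ i) (hi' : i ≤ n - 1) : freeRep d n (Gg n i) = gOp i := by
  simp [freeRep, Gg, genOp, hi, hi']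

theorem freeRep_Tt {j : ℕ} (hj : 1 ≤ j) (hj' : j ≤ n) : freeRep d n (Tt n j) = tOp j := by
  simp [freeRep, Tt, genOp, hj, hj']

theorem tOp_pow_d (j : ℕ) : tOp (d := d) j ^ d = 1 := by
  ext f x
  rw [tOp_pow_apply, colour_pow, one_mul, Module.End.one_apply]

theorem freeRep_eq_of_rel (hd : 1 ≤ d) (hn : 2 ≤ n) {x y : FA n} (h : YBrel d n x y) :
    freeRep d n x = freeRep d n y := by
  induction h with
  | gg i j hi hi' hj hj' h =>
    rw [map_mul, map_mul, freeRep_Gg hi hi', freeRep_Gg hj hj']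
    rcases h with h | h
    · exact gOp_commute h
    · exact (gOp_commute h).symm
  | braid i hi hi' =>
    simp only [map_mul]
    rw [freeRep_Gg hi (by omega), freeRep_Gg (by omega) (by omega)]
    exact gOp_braid i
  | bg i hi hi' =>
    rw [map_mul, map_mul, freeRep_Bb, freeRep_Gg (by omega) hi']
    exact bOp_commute_gOp hi
  | bgbg =>
    simp only [map_mul]
    rw [freeRep_Bb, freeRep_Gg le_rfl (by omega)]
    exact bOp_gOp_braid
  | tt i j hi hi' hj hj' =>
    rw [map_mul, map_mul, freeRep_Tt hi hi', freeRep_Tt hj hj']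
    exact tOp_commute i j
  | tg i j hi hi' hj hj' =>
    rw [map_mul, map_mul, freeRep_Gg hi hi', freeRep_Tt hj hj',
      freeRep_Tt (by unfold sAct; split_ifs <;> omega) (by unfold sAct; split_ifs <;> omega)]
    exact tOp_mul_gOp i j
  | tb i hi hi' =>
    rw [map_mul, map_mul, freeRep_Bb, freeRep_Tt hi hi']
    exact tOp_mul_bOp i
  | td i hi hi' =>
    rw [map_pow, map_one, freeRep_Tt hi hi']
    exact tOp_pow_d i
  | gsq i hi hi' =>
    simp only [eF, map_pow, map_add, map_one, map_smul, map_mul, map_sum]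
    rw [freeRep_Gg hi hi', freeRep_Tt hi (by omega), freeRep_Tt (by omega) (by omega)]
    exact gOp_sq i hd
  | bsq =>
    simp only [fF, map_pow, map_add, map_one, map_smul, map_mul, map_sum]
    rw [freeRep_Bb, freeRep_Tt le_rfl (by omega)]
    exact bOp_sq hd

/-- The representation of `Y_{d,n}^B` on functions on words. -/
def wordRep (hd : 1 ≤ d) (hn : 2 ≤ n) : YB d n →ₐ[Kf] Module.End Kf (Word d → Kf) :=
  RingQuot.liftAlgHom Kf ⟨freeRep d n, fun _ _ h => freeRep_eq_of_rel hd hn h⟩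

theorem wordRep_mkY (hd : 1 ≤ d) (hn : 2 ≤ n) (x : FA n) :
    wordRep hd hn (mkY d n x) = freeRep d n x := by
  simp [wordRep, mkY]

/-- The submodules of functions on words that are stable under the generators of `Y_{d,n}^B`. -/
structure IsStable (n : ℕ) (W : Submodule Kf (Word d → Kf)) : Prop where
  b : ∀ f ∈ W, bOp f ∈ W
  g : ∀ i, 1 ≤ i → i ≤ n - 1 → ∀ f ∈ W, gOp i f ∈ W
  t : ∀ j, 1 ≤ j → j ≤ n → ∀ f ∈ W, tOp j f ∈ W

theorem isStable_range (hd : 1 ≤ d) (hn : 2 ≤ n) (f : Word d → Kf) : IsStable n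
    (LinearMap.range ((LinearMap.applyₗ f).comp (wordRep (n := n) hd hn).toLinearMap)) := by
  have key : ∀ (y : FA n), ∀ h ∈ LinearMap.range
      ((LinearMap.applyₗ f).comp (wordRep (n := n) hd hn).toLinearMap), freeRep d n y h ∈
      LinearMap.range ((LinearMap.applyₗ f).comp (wordRep (n := n) hd hn).toLinearMap) := by
    rintro y _ ⟨z, rfl⟩
    refine ⟨mkY d n y * z, ?_⟩
    simp [wordRep_mkY]
  refine ⟨fun h hh => ?_, fun i hi hi' h hh => ?_, fun j hj hj' h hh => ?_⟩
  · exact freeRep_Bb (d := d) (n := n) ▸ key _ h hh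
  · exact freeRep_Gg (d := d) hi hi' ▸ key _ h hh
  · exact freeRep_Tt (d := d) hj hj' ▸ key _ h hh

/-- The word with prescribed letters at positions `1, …, n`. -/
def mkWord (x : Fin n → ℤ × rootsOfUnity d Kf) : Word d :=
  fun j => if h : 1 ≤ j ∧ j ≤ n then x ⟨j - 1, by omega⟩ else (0, 1)

theorem mkWord_succ (x : Fin n → ℤ × rootsOfUnity d Kf) (i : Fin n) :
    mkWord x (i + 1) = x i := by
  have := i.2
  rw [mkWord, dif_pos (by omega)]
  congr

theorem mkWord_injective : Injective (mkWord (d := d) (n := n)) := fun x y h => by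
  ext1 i
  rw [← mkWord_succ x, h, mkWord_succ]

theorem mkWord_update (x : Fin n → ℤ × rootsOfUnity d Kf) (i : Fin n)
    (p : ℤ × rootsOfUnity d Kf) : mkWord (update x i p) = update (mkWord x) (i + 1) p := by
  ext1 j
  have := i.2
  by_cases hj : 1 ≤ j ∧ j ≤ n
  · simp only [mkWord, update_apply, dif_pos hj, Fin.ext_iff]
    grind
  · rw [update_of_ne (by omega), mkWord, mkWord, dif_neg hj, dif_neg hj]

theorem update_update_eq_comp_swap {α β : Type*} [DecidableEq α] (x : α → β) {i j : α}
    (h : i ≠ j) : update (update x i (x j)) j (x i) = x ∘ Equiv.swap i j := by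
  ext1 k
  simp only [update_apply, comp_apply, Equiv.swap_apply_def]
  grind

theorem gOp_single {i : ℕ} {y : Word d} (h : y i ≠ y (i + 1)) :
    ∃ α : Kf, gOp i (Pi.single y 1) =
      Pi.single (y ∘ Equiv.swap i (i + 1)) 1 + α • Pi.single y 1 := by
  refine ⟨if (y i).2 = (y (i + 1)).2 ∧ (y (i + 1)).1 < (y i).1 then uu - uu⁻¹ else 0, ?_⟩
  ext x
  have hsw : x ∘ Equiv.swap i (i + 1) = y ↔ x = y ∘ Equiv.swap i (i + 1) := by
    constructor <;> rintro rfl <;> ext1 k <;> simp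
  have hx : x = y ∘ Equiv.swap i (i + 1) → x i = y (i + 1) ∧ x (i + 1) = y i := by
    rintro rfl; simp
  have e1 : update (update x i (x i)) (i + 1) (x (i + 1)) = x := by simp
  have e2 := update_update_eq_comp_swap x (Nat.ne_add_one i)
  simp only [gOp_apply, rMat, e1, e2, Pi.add_apply, Pi.smul_apply, Pi.single_apply, smul_eq_mul,
    hsw]
  by_cases h1 : x = y
  · subst h1
    simp only [if_neg h, if_true, mul_one]
    split_ifs <;> simp
  · simp only [h1, if_false, mul_zero, add_zero]
    by_cases h2 : x i = x (i + 1)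
    · rw [if_pos h2, if_neg]
      intro h3
      obtain ⟨h4, h5⟩ := hx h3
      exact h (by rw [← h4, ← h5, h2])
    · rw [if_neg h2, ite_self]

theorem bOp_single {y : Word d} (h : (y 1).1 ≠ 0) :
    ∃ α : Kf, bOp (Pi.single y 1) =
      Pi.single (update y 1 (-(y 1).1, (y 1).2)) 1 + α • Pi.single y 1 := by
  refine ⟨if (y 1).2 = 1 ∧ (y 1).1 < 0 then vv - vv⁻¹ else 0, ?_⟩
  ext x
  have hsw : update x 1 (-(x 1).1, (x 1).2) = y ↔ x = update y 1 (-(y 1).1, (y 1).2) := by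
    constructor <;> rintro rfl <;> simp
  have h0 : x 1 = (0, 1) → x ≠ update y 1 (-(y 1).1, (y 1).2) := by
    rintro hx rfl
    simp_all
  simp only [bOp_apply, kMat, update_eq_self, Pi.add_apply, Pi.smul_apply, Pi.single_apply,
    smul_eq_mul, hsw]
  by_cases h1 : x = y
  · subst h1
    have h2 : x 1 ≠ (0, 1) := fun h2 => h (by rw [h2])
    simp only [if_neg h2, if_true, mul_one]
    split_ifs <;> simp
  · simp only [h1, if_false, mul_zero, add_zero]
    split_ifs with h2 h3 <;> first | rfl | exact absurd ‹_› (h0 h2)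

/-- The sum of all words with letters `1, …, n` in order whose colours agree with `c` on `s`. -/
def orderedSum (s : Finset (Fin n)) (c : Fin n → rootsOfUnity d Kf) : Word d → Kf := fun x =>
  if ∃ c' : Fin n → rootsOfUnity d Kf,
    x = mkWord (fun i => ((i : ℤ) + 1, c' i)) ∧ ∀ j ∈ s, c' j = c j then 1 else 0

theorem orderedSum_univ (c : Fin n → rootsOfUnity d Kf) :
    orderedSum Finset.univ c = Pi.single (mkWord (fun i => ((i : ℤ) + 1, c i))) 1 := by
  ext x
  simp only [orderedSum, Finset.mem_univ, forall_const, Pi.single_apply, ← funext_iff,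
    exists_eq_right]

namespace IsStable

variable {W : Submodule Kf (Word d → Kf)}

theorem filter_colour_mem (hW : IsStable n W) (hd : 1 ≤ d) {j : ℕ} (hj : 1 ≤ j) (hj' : j ≤ n)
    (c : rootsOfUnity d Kf) {f : Word d → Kf} (hf : f ∈ W) :
    (fun x => if (x j).2 = c then f x else 0) ∈ W := by
  have hpow : ∀ m, (tOp j ^ m) f ∈ W := by
    intro m
    induction m with
    | zero => simpa
    | succ m ih => rw [pow_succ', Module.End.mul_apply]; exact hW.t j hj hj' _ ih
  have hc : ((c : Kfˣ) : Kf) ^ d = 1 := by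
    have := c.2
    rw [mem_rootsOfUnity] at this
    simpa using congrArg Units.val this
  convert W.smul_mem (d : Kf)⁻¹ (W.sum_mem (t := Finset.range d) fun m _ =>
    W.smul_mem (((c : Kfˣ) : Kf) ^ (d - m)) (hpow m)) using 1
  ext x
  have h := average_div hd (colour_pow x j) hc
  have h2 : colour x j = ((c : Kfˣ) : Kf) ↔ (x j).2 = c := by simp [colour, Units.val_inj]
  simp only [Pi.smul_apply, Finset.sum_apply, tOp_pow_apply, smul_eq_mul]
  simp only [h2] at h
  have h3 : ∀ m, ((c : Kfˣ) : Kf) ^ (d - m) * (colour x j ^ m * f x) =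
    colour x j ^ m * ((c : Kfˣ) : Kf) ^ (d - m) * f x := fun m => by ring
  simp only [h3]
  rw [← Finset.sum_mul, ← mul_assoc, h]
  split_ifs <;> simp

theorem orderedSum_mem (hW : IsStable n W) (hd : 1 ≤ d) (c : Fin n → rootsOfUnity d Kf)
    (h : orderedSum ∅ c ∈ W) (s : Finset (Fin n)) : orderedSum s c ∈ W := by
  induction s using Finset.induction_on with
  | empty => exact h
  | insert j s _ ih =>
    convert hW.filter_colour_mem hd (j := j + 1) (by omega) j.2 (c j) ih using 1
    ext x
    simp only [orderedSum]
    rw [← ite_and]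
    refine if_congr ?_ rfl rfl
    simp only [Finset.mem_insert, forall_eq_or_imp]
    constructor
    · rintro ⟨c', rfl, h1, h2⟩
      exact ⟨by rw [mkWord_succ]; exact h1, c', rfl, h2⟩
    · rintro ⟨h1, c', rfl, h2⟩
      rw [mkWord_succ] at h1
      exact ⟨c', rfl, h1, h2⟩

theorem comp_perm_mem (hW : IsStable n W) (π : Equiv.Perm (Fin n))
    {x : Fin n → ℤ × rootsOfUnity d Kf} (hx : Injective x)
    (h : Pi.single (mkWord x) 1 ∈ W) : Pi.single (mkWord (x ∘ π)) 1 ∈ W := by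
  obtain _ | n := n
  · rwa [Subsingleton.elim (x ∘ π) x]
  have hπ : π ∈ Submonoid.closure
      (Set.range fun i : Fin n => Equiv.swap i.castSucc i.succ) := by
    rw [Equiv.Perm.mclosure_swap_castSucc_succ]
    trivial
  induction hπ using Submonoid.closure_induction generalizing x with
  | one => exact h
  | mul π σ _ _ ih1 ih2 => exact ih2 (hx.comp π.injective) (ih1 hx h)
  | mem _ hmem =>
    obtain ⟨i, rfl⟩ := hmem
    have e1 : mkWord x (i + 1) = x i.castSucc := mkWord_succ x i.castSucc
    have e2 : mkWord x (i + 1 + 1) = x i.succ := mkWord_succ x i.succ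
    have hne : mkWord x (i + 1) ≠ mkWord x (i + 1 + 1) := by
      rw [e1, e2]
      exact hx.ne (Fin.castSucc_lt_succ).ne
    obtain ⟨α, hα⟩ := gOp_single hne
    have e3 : mkWord (x ∘ Equiv.swap i.castSucc i.succ) =
        mkWord x ∘ Equiv.swap (i + 1 : ℕ) (i + 1 + 1) := by
      rw [← update_update_eq_comp_swap _ (Fin.castSucc_lt_succ).ne,
        ← update_update_eq_comp_swap _ (Nat.ne_add_one _), mkWord_update, mkWord_update, e1, e2]
      rfl
    rw [e3, ← add_sub_cancel_right (Pi.single _ 1) (α • Pi.single (mkWord x) 1), ← hα]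
    exact W.sub_mem (hW.g _ (by omega) (by have := i.2; omega) _ h) (W.smul_mem _ h)

theorem negate_mem (hW : IsStable n W) (k : Fin n) {x : Fin n → ℤ × rootsOfUnity d Kf}
    (hx : Injective fun i => (x i).1.natAbs) (hk : (x k).1 ≠ 0)
    (h : Pi.single (mkWord x) 1 ∈ W) :
    Pi.single (mkWord (update x k (-(x k).1, (x k).2))) 1 ∈ W := by
  obtain _ | n := n
  · exact k.elim0
  have inj : ∀ {x : Fin (n + 1) → ℤ × rootsOfUnity d Kf},
      Injective (fun i => (x i).1.natAbs) → Injective x :=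
    fun hx i j hij => hx (by simp only [hij])
  have first : ∀ x : Fin (n + 1) → ℤ × rootsOfUnity d Kf, (x 0).1 ≠ 0 →
      Pi.single (mkWord x) 1 ∈ W →
      Pi.single (mkWord (update x 0 (-(x 0).1, (x 0).2))) 1 ∈ W := by
    intro x hx h
    have e1 : mkWord x 1 = x 0 := mkWord_succ x 0
    obtain ⟨α, hα⟩ := bOp_single (y := mkWord x) (by rwa [e1])
    have e2 : mkWord (update x 0 (-(x 0).1, (x 0).2)) =
        update (mkWord x) 1 (-(mkWord x 1).1, (mkWord x 1).2) := by
      rw [mkWord_update, e1]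
      rfl
    rw [e2, ← add_sub_cancel_right (Pi.single _ 1) (α • Pi.single (mkWord x) 1), ← hα]
    exact W.sub_mem (hW.b _ h) (W.smul_mem _ h)
  have h1 := hW.comp_perm_mem (Equiv.swap 0 k) (inj hx) h
  have h2 := first _ (by simpa using hk) h1
  have h3 := hW.comp_perm_mem (Equiv.swap 0 k) (inj (fun i j hij => ?_)) h2
  · convert h3 using 3
    ext1 i
    simp only [update_apply, comp_apply, Equiv.swap_apply_left, Equiv.swap_apply_def]
    grind
  · refine (hx.comp (Equiv.swap 0 k).injective) ?_
    simp only [update_apply, comp_apply] at hij ⊢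
    grind

end IsStable

/-- The word `i ↦ ± π(i)` with colours `c`, where the signs are negative exactly on `s`. -/
def signedWord (p : Equiv.Perm (Fin n) × Finset (Fin n) × (Fin n → rootsOfUnity d Kf)) :
    Fin n → ℤ × rootsOfUnity d Kf :=
  fun i => (if i ∈ p.2.1 then -((p.1 i : ℤ) + 1) else (p.1 i : ℤ) + 1, p.2.2 i)

theorem natAbs_signedWord
    (p : Equiv.Perm (Fin n) × Finset (Fin n) × (Fin n → rootsOfUnity d Kf)) (i : Fin n) :
    (signedWord p i).1.natAbs = p.1 i + 1 := by
  simp only [signedWord]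
  split_ifs <;> omega

theorem signedWord_injective : Injective (signedWord (d := d) (n := n)) := by
  intro p q h
  refine Prod.ext (Equiv.ext fun i => ?_) (Prod.ext (Finset.ext fun i => ?_) (funext fun i => ?_))
  · have h1 := natAbs_signedWord p i
    rw [h, natAbs_signedWord] at h1
    exact Fin.ext (by omega)
  · have h1 := congrArg Prod.fst (congrFun h i)
    simp only [signedWord] at h1
    split_ifs at h1 with h2 h3 h3
    · simp [h2, h3]
    · omega
    · omega
    · simp [h2, h3]
  · exact congrArg Prod.snd (congrFun h i)

theorem IsStable.single_signedWord_mem {W : Submodule Kf (Word d → Kf)} (hW : IsStable n W)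
    (hd : 1 ≤ d) (h : orderedSum (d := d) (n := n) ∅ 1 ∈ W)
    (p : Equiv.Perm (Fin n) × Finset (Fin n) × (Fin n → rootsOfUnity d Kf)) :
    Pi.single (mkWord (signedWord p)) 1 ∈ W := by
  obtain ⟨π, s, c⟩ := p
  induction s using Finset.induction_on with
  | empty =>
    have h0 : orderedSum (d := d) (n := n) ∅ 1 = orderedSum ∅ (c ∘ π.symm) := by
      ext x
      simp [orderedSum]
    have h1 := hW.orderedSum_mem hd _ (h0 ▸ h) Finset.univ
    rw [orderedSum_univ] at h1
    convert hW.comp_perm_mem π (fun i j hij => ?_) h1 using 3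
    · ext1 i
      simp [signedWord]
    · have := congrArg Prod.fst hij
      exact Fin.ext (by simpa using this)
  | insert k s hk ih =>
    convert hW.negate_mem k (fun i j hij => ?_) ?_ ih using 3
    · ext1 i
      simp only [signedWord, update_apply, Finset.mem_insert]
      split_ifs <;> simp_all
    · simp only [natAbs_signedWord] at hij
      exact π.injective (Fin.ext (by simpa using hij))
    · have := natAbs_signedWord (π, s, c) k
      omega

theorem card_rootsOfUnity_Kf (hd : 1 ≤ d) : Nat.card (rootsOfUnity d Kf) = d := by
  have : NeZero d := ⟨by omega⟩
  exact ((Complex.isPrimitiveRoot_exp d (by omega)).map_of_injective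
    (algebraMap ℂ Kf).injective).card_rootsOfUnity

theorem two_pow_mul_le_finrank (hd : 1 ≤ d) (hn : 2 ≤ n) [Module.Finite Kf (YB d n)] :
    2 ^ n * d ^ n * n.factorial ≤ Module.finrank Kf (YB d n) := by
  have : Fintype (rootsOfUnity d Kf) :=
    @Fintype.ofFinite _ (Nat.finite_of_card_ne_zero (by rw [card_rootsOfUnity_Kf hd]; omega))
  let ev := (LinearMap.applyₗ (orderedSum (d := d) (n := n) ∅ 1)).comp
    (wordRep (n := n) hd hn).toLinearMap
  have hmem : ∀ p, ∃ y, ev y = Pi.single (mkWord (signedWord p)) 1 :=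
    (isStable_range hd hn _).single_signedWord_mem hd ⟨1, by simp⟩
  choose y hy using hmem
  have hli : LinearIndependent Kf (ev ∘ y) := by
    have : ev ∘ y = (fun w : Word d => (Pi.single w 1 : Word d → Kf)) ∘ mkWord ∘ signedWord :=
      funext hy
    rw [this]
    exact (Pi.linearIndependent_single_one (Word d) Kf).comp _
      (mkWord_injective.comp signedWord_injective)
  have h := (hli.of_comp).fintype_card_le_finrank
  rw [Fintype.card_prod, Fintype.card_prod, Fintype.card_perm, Fintype.card_finset,
    Fintype.card_fun, Fintype.card_fin, ← Nat.card_eq_fintype_card (α := rootsOfUnity d Kf),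
    card_rootsOfUnity_Kf hd] at h
  linarith

end Representation

/-- `𝖣_n` is a `K`-linear basis of `Y_{d,n}^B`, and consequently
`dim_K Y_{d,n}^B = 2^n d^n n!`. -/
theorem stmt8 (d n : ℕ) (hd : 1 ≤ d) (hn : 2 ≤ n) :
    LinearIndependent Kf ((↑) : (Dset d n) → YB d n) ∧
    Submodule.span Kf (Dset d n) = ⊤ ∧
    Module.finrank Kf (YB d n) = 2 ^ n * d ^ n * n.factorial := by
  have hspan := span_Dset (n := n) hd hn
  obtain ⟨hfin, hcard⟩ : (Dset d n).Finite ∧ (Dset d n).ncard ≤ 2 ^ n * d ^ n * n.factorial :=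
    Dprefix_finite_ncard_le hd n
  have : Module.Finite Kf (YB d n) := ⟨hfin.toFinset, by simpa using hspan⟩
  have : Fintype (Dset d n) := hfin.fintype
  rw [← Nat.card_coe_set_eq, Nat.card_eq_fintype_card] at hcard
  have hle : Module.finrank Kf (YB d n) ≤ Fintype.card (Dset d n) := by
    have h := finrank_range_le_card (R := Kf) ((↑) : Dset d n → YB d n)
    rwa [Set.finrank, Subtype.range_coe, hspan, finrank_top] at h
  have hge := two_pow_mul_le_finrank (n := n) hd hn
  refine ⟨linearIndependent_of_top_le_span_of_card_eq_finrank ?_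
    ((hcard.trans hge).antisymm hle), hspan, (hle.trans hcard).antisymm hge⟩
  rw [Subtype.range_coe, hspan]
end
end

section
/- The tensorial representation Φ : Y_{d,n}^B → End(V^{⊗n}) is faithful, i.e. Φ is an injective algebra homomorphism. -/
set_option maxHeartbeats 1000000
set_option synthInstance.maxHeartbeats 400000

noncomputable section

/-- The index set `X_n = {-n, …, -1, 1, …, n}`. -/
abbrev Xn (n : ℕ) : Type := {i : ℤ // i ≠ 0 ∧ i.natAbs ≤ n}

/-- Negation on `X_n`. -/
def negX (n : ℕ) (x : Xn n) : Xn n :=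
  ⟨-x.val, by obtain ⟨h1, h2⟩ := x.2; omega⟩

/-- The index set of the natural basis of `V^{⊗n}`: a basis vector
`v_{i_1}^{r_1} ⊗ ⋯ ⊗ v_{i_n}^{r_n}` corresponds to the function `p ↦ (i_{p+1}, r_{p+1})`. -/
abbrev BIdx (d n : ℕ) : Type := Fin n → Xn n × Fin d

/-- The vector space `V^{⊗n}`, realized as the space with basis indexed by `BIdx d n`. -/
abbrev Vn (d n : ℕ) : Type := BIdx d n →₀ Kf

/-- The basis vector of `V^{⊗n}` indexed by `f`. -/
def bv (d n : ℕ) (f : BIdx d n) : Vn d n := Finsupp.single f 1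

/-- The endomorphism of `V^{⊗n}` with prescribed values on the basis. -/
def opOf (d n : ℕ) (F : BIdx d n → Vn d n) : Module.End Kf (Vn d n) :=
  Finsupp.linearCombination Kf F

/-- The image in `K` of a complex number (in particular of the root of unity `ω`). -/
def cK (w : ℂ) : Kf := algebraMap (MvPolynomial (Fin 2) ℂ) Kf (MvPolynomial.C w)

/-- The endomorphism `T_k = 1⊗⋯⊗T⊗⋯⊗1` of `V^{⊗n}` (for `1 ≤ k ≤ n`; junk `1` out of
range), where `(v_i^r) T = ω^r v_i^r`. -/
def TOp (w : ℂ) (d n k : ℕ) : Module.End Kf (Vn d n) :=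
  if h : 1 ≤ k ∧ k ≤ n then
    opOf d n (fun f => cK w ^ ((f ⟨k - 1, by omega⟩).2 : ℕ) • bv d n f)
  else 1

/-- The inverse `T_k⁻¹` of the endomorphism `T_k`. -/
def TinvOp (w : ℂ) (d n k : ℕ) : Module.End Kf (Vn d n) :=
  if h : 1 ≤ k ∧ k ≤ n then
    opOf d n (fun f => (cK w ^ ((f ⟨k - 1, by omega⟩).2 : ℕ))⁻¹ • bv d n f)
  else 1

/-- The endomorphism `E_k = (1/d) ∑_{m=0}^{d-1} T_k^m T_{k+1}^{-m}`. -/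
def EOp (w : ℂ) (d n k : ℕ) : Module.End Kf (Vn d n) :=
  (d : Kf)⁻¹ • ∑ m ∈ Finset.range d, TOp w d n k ^ m * TinvOp w d n (k + 1) ^ m

/-- The endomorphism `F = (1/d) ∑_{m=0}^{d-1} T_1^m`. -/
def FOp (w : ℂ) (d n : ℕ) : Module.End Kf (Vn d n) :=
  (d : Kf)⁻¹ • ∑ m ∈ Finset.range d, TOp w d n 1 ^ m

/-- The endomorphism `G_i = 1⊗⋯⊗G⊗⋯⊗1` of `V^{⊗n}` (acting on the tensor factors `i`,
`i+1`, for `1 ≤ i ≤ n-1`; junk `1` out of range). -/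
def GOp (d n i : ℕ) : Module.End Kf (Vn d n) :=
  if h : 1 ≤ i ∧ i ≤ n - 1 then
    opOf d n (fun f =>
      let p : Fin n := ⟨i - 1, by omega⟩
      let q : Fin n := ⟨i, by omega⟩
      let fs : BIdx d n := f ∘ (Equiv.swap p q)
      if (f p).2 ≠ (f q).2 then bv d n fs
      else if (f p).1.val = (f q).1.val then uu • bv d n fs
      else if (f p).1.val < (f q).1.val then bv d n fs
      else bv d n fs + (uu - uu⁻¹) • bv d n f)
  else 1

/-- The endomorphism `B_1` of `V^{⊗n}`. -/
def BOp (d n : ℕ) : Module.End Kf (Vn d n) :=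
  if h : 1 ≤ n then
    opOf d n (fun f =>
      let p : Fin n := ⟨0, by omega⟩
      let fneg : BIdx d n := Function.update f p (negX n (f p).1, (f p).2)
      if ((f p).2 : ℕ) ≠ 0 then bv d n fneg
      else if 0 < (f p).1.val then bv d n fneg
      else bv d n fneg + (vv - vv⁻¹) • bv d n f)
  else 1

/-- The action of the `i`-th simple reflection of type `B` on basis indices: a sign change in the
first position for `i = 0`, and the swap of the positions `i - 1` and `i` otherwise. -/
def reflect {d n : ℕ} (i : Fin n) (f : BIdx d n) : BIdx d n :=
  if i.val = 0 then Function.update f i (negX n (f i).1, (f i).2)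
  else f ∘ Equiv.swap ⟨i.val - 1, by omega⟩ i

/-- The `i`-th simple reflection is a descent of `f`. -/
def IsDescent {d n : ℕ} (i : Fin n) (f : BIdx d n) : Prop :=
  (i.val = 0 ∧ (f i).1.val < 0) ∨
    (i.val ≠ 0 ∧ (f i).1.val < (f ⟨i.val - 1, by omega⟩).1.val)

/-- The absolute values of the entries of `f` are pairwise distinct. -/
def AbsInjective {d n : ℕ} (f : BIdx d n) : Prop :=
  Function.Injective fun p => (f p).1.val.natAbs

theorem reflect_apply_val {d n : ℕ} (i p : Fin n) (f : BIdx d n) :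
    (reflect i f p).1.val =
      if i.val = 0 then (if p.val = 0 then -(f p).1.val else (f p).1.val)
      else (f (Equiv.swap ⟨i.val - 1, by omega⟩ i p)).1.val := by
  unfold reflect
  split_ifs with h0 h1
  · obtain rfl : p = i := Fin.ext (by omega)
    simp [negX]
  · rw [Function.update_of_ne]
    exact fun h => h1 (h ▸ h0)
  · rfl

theorem reflect_apply_label {d n : ℕ} (i p : Fin n) (f : BIdx d n) :
    (reflect i f p).2 =
      if i.val = 0 then (f p).2 else (f (Equiv.swap ⟨i.val - 1, by omega⟩ i p)).2 := by
  unfold reflect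
  split_ifs with h0
  · by_cases h : p = i
    · subst h; simp
    · rw [Function.update_of_ne h]
  · rfl

theorem bIdx_ext {d n : ℕ} {f g : BIdx d n} (h₁ : ∀ p, (f p).1.val = (g p).1.val)
    (h₂ : ∀ p, (f p).2 = (g p).2) : f = g :=
  funext fun p => Prod.ext (Subtype.ext (h₁ p)) (h₂ p)

theorem reflect_reflect {d n : ℕ} (i : Fin n) (f : BIdx d n) : reflect i (reflect i f) = f := by
  refine bIdx_ext (fun p => ?_) fun p => ?_
  · simp only [reflect_apply_val]
    split_ifs <;> simp
  · simp only [reflect_apply_label]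
    split_ifs <;> simp

theorem reflect_apply_of_ne {d n : ℕ} {i p : Fin n} (f : BIdx d n) (h : p ≠ i)
    (h' : p.val + 1 ≠ i.val) : reflect i f p = f p := by
  unfold reflect
  split_ifs with h0
  · rw [Function.update_of_ne h]
  · rw [Function.comp_apply, Equiv.swap_apply_of_ne_of_ne _ h]
    intro e
    rw [e] at h'
    exact h' (by simp only; omega)

theorem reflect_apply_self {d n : ℕ} {i : Fin n} (f : BIdx d n) (h : i.val ≠ 0) :
    reflect i f i = f ⟨i.val - 1, by omega⟩ := by
  unfold reflect
  rw [if_neg h, Function.comp_apply, Equiv.swap_apply_right]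

theorem reflect_apply_pred {d n : ℕ} {i p : Fin n} (f : BIdx d n) (h : p.val + 1 = i.val) :
    reflect i f p = f i := by
  have hp : p = ⟨i.val - 1, by omega⟩ := Fin.ext (by simp only; omega)
  unfold reflect
  rw [if_neg (by omega), Function.comp_apply, hp, Equiv.swap_apply_left]

theorem reflect_apply_zero {d n : ℕ} {i : Fin n} (f : BIdx d n) (h : i.val = 0) :
    reflect i f i = (negX n (f i).1, (f i).2) := by
  unfold reflect
  rw [if_pos h, Function.update_self]

theorem absInjective_reflect {d n : ℕ} {i : Fin n} {f : BIdx d n} (hf : AbsInjective f) :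
    AbsInjective (reflect i f) := by
  by_cases h0 : i.val = 0
  · have : (fun p => (reflect i f p).1.val.natAbs) = fun p => (f p).1.val.natAbs := by
      funext p
      rw [reflect_apply_val, if_pos h0]
      split_ifs <;> simp
    unfold AbsInjective
    rwa [this]
  · have : (fun p => (reflect i f p).1.val.natAbs)
        = (fun p => (f p).1.val.natAbs) ∘ Equiv.swap ⟨i.val - 1, by omega⟩ i := by
      funext p
      rw [reflect_apply_val, if_neg h0]
      rfl
    unfold AbsInjective
    rw [this]
    exact hf.comp (Equiv.injective _)

theorem absInjective_reflect_iff {d n : ℕ} {i : Fin n} {f : BIdx d n} :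
    AbsInjective (reflect i f) ↔ AbsInjective f :=
  ⟨fun h => reflect_reflect i f ▸ absInjective_reflect h, absInjective_reflect⟩

theorem isDescent_reflect {d n : ℕ} {i : Fin n} {f : BIdx d n} (hf : AbsInjective f)
    (h : ¬ IsDescent i f) : IsDescent i (reflect i f) := by
  by_cases h0 : i.val = 0
  · refine Or.inl ⟨h0, ?_⟩
    have h1 : ¬ (f i).1.val < 0 := fun h1 => h (Or.inl ⟨h0, h1⟩)
    have h2 := (f i).1.2.1
    rw [reflect_apply_val, if_pos h0, if_pos h0]
    omega
  · refine Or.inr ⟨h0, ?_⟩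
    have h1 : ¬ (f i).1.val < (f ⟨i.val - 1, by omega⟩).1.val := fun h1 => h (Or.inr ⟨h0, h1⟩)
    have h2 : (f i).1.val ≠ (f ⟨i.val - 1, by omega⟩).1.val := by
      intro e
      have := congrArg Fin.val (hf (congrArg Int.natAbs e))
      simp only at this
      omega
    rw [reflect_apply_self f h0, reflect_apply_pred f (by simp only; omega)]
    omega

/-- A potential on basis indices which strictly increases along descents. -/
def potential {d n : ℕ} (f : BIdx d n) : ℤ := ∑ p : Fin n, ((p.val : ℤ) + 1) * (f p).1.val

theorem potential_lt_potential_reflect {d n : ℕ} {i : Fin n} {f : BIdx d n} (h : IsDescent i f) :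
    potential f < potential (reflect i f) := by
  unfold potential
  rcases h with ⟨h0, h⟩ | ⟨h0, h⟩
  · refine Finset.sum_lt_sum (fun p _ => ?_) ⟨i, Finset.mem_univ _, ?_⟩
    · rw [reflect_apply_val, if_pos h0]
      split_ifs with hp
      · obtain rfl : p = i := Fin.ext (by omega)
        nlinarith
      · exact le_rfl
    · rw [reflect_apply_val, if_pos h0, if_pos h0]
      nlinarith
  · set q : Fin n := ⟨i.val - 1, by omega⟩ with hq
    have hqi : q ≠ i := fun e => by
      have := congrArg Fin.val e
      simp only [hq] at this
      omega
    have hi : i ∈ Finset.univ.erase q := Finset.mem_erase.2 ⟨hqi.symm, Finset.mem_univ _⟩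
    rw [← Finset.add_sum_erase _ _ (Finset.mem_univ q), ← Finset.add_sum_erase _ _ hi,
      ← Finset.add_sum_erase _ _ (Finset.mem_univ q), ← Finset.add_sum_erase _ _ hi,
      reflect_apply_self f h0, reflect_apply_pred f (show q.val + 1 = i.val by simp only [hq]; omega)]
    have hs : ∑ p ∈ (Finset.univ.erase q).erase i, ((p.val : ℤ) + 1) * (reflect i f p).1.val
        = ∑ p ∈ (Finset.univ.erase q).erase i, ((p.val : ℤ) + 1) * (f p).1.val := by
      refine Finset.sum_congr rfl fun p hp => ?_
      simp only [Finset.mem_erase, Finset.mem_univ, and_true] at hp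
      rw [reflect_apply_of_ne f hp.1]
      intro e
      exact hp.2 (Fin.ext (by simp only [hq]; omega))
    rw [hs, ← hq]
    have : (q.val : ℤ) + 1 = i.val := by simp only [hq]; omega
    nlinarith

theorem potential_le {d n : ℕ} (f : BIdx d n) :
    potential f ≤ ∑ p : Fin n, ((p.val : ℤ) + 1) * n := by
  refine Finset.sum_le_sum fun p _ => mul_le_mul_of_nonneg_left ?_ (by positivity)
  have := (f p).1.2.2
  omega

/-- A natural number which strictly decreases along descents. -/
def corank {d n : ℕ} (f : BIdx d n) : ℕ :=
  (∑ p : Fin n, ((p.val : ℤ) + 1) * n - potential f).toNat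

theorem corank_reflect_lt {d n : ℕ} {i : Fin n} {f : BIdx d n} (h : IsDescent i f) :
    corank (reflect i f) < corank f := by
  have h1 := potential_lt_potential_reflect h
  have h2 := potential_le (reflect i f)
  unfold corank
  omega

theorem isDescent_reflect_of_far {d n : ℕ} {i j : Fin n} {f : BIdx d n}
    (hij : i.val + 1 < j.val ∨ j.val + 1 < i.val) : IsDescent j (reflect i f) ↔ IsDescent j f := by
  unfold IsDescent
  have hji : j ≠ i := fun e => by subst e; omega
  rw [reflect_apply_of_ne f hji (by omega)]
  by_cases h0 : j.val = 0
  · simp [h0]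
  · rw [reflect_apply_of_ne f _ (by simp only; omega)]
    intro e
    have := congrArg Fin.val e
    simp only at this
    omega

theorem reflect_comm_of_far {d n : ℕ} {i j : Fin n} (f : BIdx d n) (hij : i.val + 1 < j.val) :
    reflect i (reflect j f) = reflect j (reflect i f) := by
  funext p
  have hji : j ≠ i := fun e => by subst e; omega
  by_cases hp : p = i ∨ p.val + 1 = i.val
  · have e1 : ∀ g : BIdx d n, reflect j g p = g p := fun g =>
      reflect_apply_of_ne g (by rintro rfl; rcases hp with rfl | hp <;> omega)
        (by rcases hp with rfl | hp <;> omega)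
    have e2 : reflect j f i = f i := reflect_apply_of_ne f (Ne.symm hji) (by omega)
    rw [e1]
    by_cases h0 : i.val = 0
    · obtain rfl : p = i := hp.resolve_right (by omega)
      rw [reflect_apply_zero _ h0, reflect_apply_zero _ h0, e2]
    · rcases hp with rfl | hp
      · rw [reflect_apply_self _ h0, reflect_apply_self _ h0,
          reflect_apply_of_ne f (by intro e; have := congrArg Fin.val e; simp only at this; omega)
            (by simp only; omega)]
      · rw [reflect_apply_pred _ hp, reflect_apply_pred _ hp, e2]
  · push Not at hp
    rw [reflect_apply_of_ne _ hp.1 hp.2]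
    by_cases hp1 : p = j
    · subst hp1
      rw [reflect_apply_self _ (by omega), reflect_apply_self _ (by omega),
        reflect_apply_of_ne f (by intro e; have := congrArg Fin.val e; simp only at this; omega)
          (by simp only; omega)]
    · by_cases hp2 : p.val + 1 = j.val
      · rw [reflect_apply_pred _ hp2, reflect_apply_pred _ hp2,
          reflect_apply_of_ne f hji (by omega)]
      · rw [reflect_apply_of_ne _ hp1 hp2, reflect_apply_of_ne _ hp1 hp2,
          reflect_apply_of_ne _ hp.1 hp.2]

section NormalForm

variable {d n : ℕ} {A : Type*} [Ring A]

open Classical in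
/-- The element of `A` obtained by following descents of `f` down to an index without descents,
multiplying by the corresponding generators. -/
def descentProd (gen : Fin n → A) (base : BIdx d n → A) (f : BIdx d n) : A :=
  if h : ∃ i, IsDescent i f then gen h.choose * descentProd gen base (reflect h.choose f)
  else base f
termination_by corank f
decreasing_by exact corank_reflect_lt h.choose_spec

/-- The braid relations of type `B` for a family of elements of a ring. -/
structure TypeBBraid (gen : Fin n → A) : Prop where
  comm : ∀ i j : Fin n, i.val + 1 < j.val → gen i * gen j = gen j * gen i
  braid : ∀ i j : Fin n, i.val ≠ 0 → j.val = i.val + 1 →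
    gen i * gen j * gen i = gen j * gen i * gen j
  braid₄ : ∀ i j : Fin n, i.val = 0 → j.val = 1 →
    gen i * gen j * gen i * gen j = gen j * gen i * gen j * gen i

theorem descentProd_eq_of_isDescent {gen : Fin n → A} (base : BIdx d n → A)
    (hg : TypeBBraid gen) {f : BIdx d n} {i : Fin n} (hi : IsDescent i f) :
    descentProd gen base f = gen i * descentProd gen base (reflect i f) := by
  induction hk : corank f using Nat.strong_induction_on generalizing f i with
  | _ k ih =>
  subst hk
  have key : ∀ i j : Fin n, i.val < j.val → IsDescent i f → IsDescent j f →
      gen i * descentProd gen base (reflect i f) = gen j * descentProd gen base (reflect j f) := by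
    intro i j hij hi hj
    have step : ∀ (g : BIdx d n) (a : Fin n), corank g < corank f → IsDescent a g →
        descentProd gen base g = gen a * descentProd gen base (reflect a g) ∧
          corank (reflect a g) < corank f := fun g a hg' ha =>
      ⟨ih _ hg' ha rfl, (corank_reflect_lt ha).trans hg'⟩
    have ci := corank_reflect_lt hi
    have cj := corank_reflect_lt hj
    rcases Nat.lt_or_ge (i.val + 1) j.val with h | h
    · rw [(step _ j ci ((isDescent_reflect_of_far (Or.inl h)).2 hj)).1,
        (step _ i cj ((isDescent_reflect_of_far (Or.inr h)).2 hi)).1,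
        ← mul_assoc, ← mul_assoc, hg.comm i j h, reflect_comm_of_far f h]
    · have hji : j.val = i.val + 1 := by omega
      have hjp : (⟨j.val - 1, by omega⟩ : Fin n) = i := Fin.ext (by simp only; omega)
      have hne : i ≠ j := fun e => by subst e; omega
      have hj0 : j.val ≠ 0 := by omega
      have hdj : ∀ g : BIdx d n, IsDescent j g ↔ (g j).1.val < (g i).1.val := fun g => by
        unfold IsDescent
        rw [hjp]
        tauto
      have rjj : ∀ g : BIdx d n, reflect j g j = g i := fun g => by
        rw [reflect_apply_self g hj0, hjp]
      have rji : ∀ g : BIdx d n, reflect j g i = g j := fun g => reflect_apply_pred g (by omega)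
      have rij : ∀ g : BIdx d n, reflect i g j = g j := fun g =>
        reflect_apply_of_ne g hne.symm (by omega)
      have hfj := (hdj f).1 hj
      by_cases h0 : i.val = 0
      · have hdi : ∀ g : BIdx d n, IsDescent i g ↔ (g i).1.val < 0 := fun g => by
          unfold IsDescent
          tauto
        have rii : ∀ g : BIdx d n, reflect i g i = (negX n (g i).1, (g i).2) := fun g =>
          reflect_apply_zero g h0
        have hfi := (hdi f).1 hi
        have hv : ∀ x : Xn n, (negX n x).val = -x.val := fun _ => rfl
        obtain ⟨a1, c1⟩ := step _ j ci (by rw [hdj, rij, rii, hv]; omega)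
        obtain ⟨a2, c2⟩ := step _ i c1 (by rw [hdi, rji, rij]; omega)
        obtain ⟨a3, c3⟩ := step _ j c2 (by
          rw [hdj, rij, rii, rjj, rji, rii, rij, hv, hv]; omega)
        obtain ⟨b1, e1⟩ := step _ i cj (by rw [hdi, rji]; omega)
        obtain ⟨b2, e2⟩ := step _ j e1 (by rw [hdj, rij, rii, rji, rjj, hv]; omega)
        obtain ⟨b3, e3⟩ := step _ i e2 (by rw [hdi, rji, rij, rjj]; omega)
        have hend : reflect j (reflect i (reflect j (reflect i f)))
            = reflect i (reflect j (reflect i (reflect j f))) := by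
          funext p
          by_cases hpi : p = i
          · subst hpi
            simp only [rij, rii, rji, rjj]
          · by_cases hpj : p = j
            · subst hpj
              simp only [rij, rii, rji, rjj]
            · have x1 : p.val + 1 ≠ i.val := by omega
              have x2 : p.val + 1 ≠ j.val := fun e => hpi (Fin.ext (by omega))
              simp only [reflect_apply_of_ne _ hpi x1, reflect_apply_of_ne _ hpj x2]
        rw [a1, a2, a3, b1, b2, b3, hend]
        have := hg.braid₄ i j h0 (by omega)
        simp only [← mul_assoc]
        rw [this]
      · set q : Fin n := ⟨i.val - 1, by omega⟩ with hq
        have hqi : q.val + 1 = i.val := by simp only [hq]; omega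
        have hdi : ∀ g : BIdx d n, IsDescent i g ↔ (g i).1.val < (g q).1.val := fun g => by
          unfold IsDescent
          tauto
        have rii : ∀ g : BIdx d n, reflect i g i = g q := fun g => reflect_apply_self g h0
        have riq : ∀ g : BIdx d n, reflect i g q = g i := fun g => reflect_apply_pred g hqi
        have hqj : q ≠ j := fun e => by have := congrArg Fin.val e; omega
        have rjq : ∀ g : BIdx d n, reflect j g q = g q := fun g =>
          reflect_apply_of_ne g hqj (by omega)
        have hfi := (hdi f).1 hi
        obtain ⟨a1, c1⟩ := step _ j ci (by rw [hdj, rij, rii]; omega)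
        obtain ⟨a2, c2⟩ := step _ i c1 (by rw [hdi, rji, rij, rjq, riq]; omega)
        obtain ⟨b1, e1⟩ := step _ i cj (by rw [hdi, rji, rjq]; omega)
        obtain ⟨b2, e2⟩ := step _ j e1 (by rw [hdj, rij, rii, rjj, rjq]; omega)
        have hend : reflect i (reflect j (reflect i f)) = reflect j (reflect i (reflect j f)) := by
          funext p
          by_cases hpi : p = i
          · subst hpi
            simp only [rij, rii, riq, rji, rjj, rjq]
          · by_cases hpj : p = j
            · subst hpj
              simp only [rij, rii, rjj, rjq]
            · by_cases hpq : p = q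
              · rw [hpq]
                simp only [rij, riq, rji, rjq]
              · have x1 : p.val + 1 ≠ i.val := fun e => hpq (Fin.ext (by omega))
                have x2 : p.val + 1 ≠ j.val := fun e => hpi (Fin.ext (by omega))
                simp only [reflect_apply_of_ne _ hpi x1, reflect_apply_of_ne _ hpj x2]
        rw [a1, a2, b1, b2, hend]
        have := hg.braid i j h0 hji
        simp only [← mul_assoc]
        rw [this]
  have hex : ∃ i, IsDescent i f := ⟨i, hi⟩
  rw [descentProd, dif_pos hex]
  rcases lt_trichotomy hex.choose.val i.val with h | h | h
  · exact key _ _ h hex.choose_spec hi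
  · rw [Fin.ext h]
  · exact (key _ _ h hi hex.choose_spec).symm

theorem descentProd_eigen {K : Type*} [Field K] [Algebra K A] {gen : Fin n → A}
    {base : BIdx d n → A} (T : Fin n → A) (ζ : Fin d → K)
    (hT : ∀ i k : Fin n, T k * gen i =
      gen i * T (if i.val = 0 then k else Equiv.swap ⟨i.val - 1, by omega⟩ i k))
    (hbase : ∀ f k, T k * base f = ζ (f k).2 • base f) (f : BIdx d n) (k : Fin n) :
    T k * descentProd gen base f = ζ (f k).2 • descentProd gen base f := by
  induction hk : corank f using Nat.strong_induction_on generalizing f k with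
  | _ m ih =>
  subst hk
  rw [descentProd]
  split_ifs with hex
  · rw [← mul_assoc, hT, mul_assoc, ih _ (corank_reflect_lt hex.choose_spec) _ _ rfl,
      mul_smul_comm, reflect_apply_label]
    split_ifs <;> simp
  · exact hbase f k

end NormalForm

theorem geom_sum_eq_zero_of_pow_eq_one {K : Type*} [Field K] {d : ℕ} {x : K} (hx : x ^ d = 1)
    (hx1 : x ≠ 1) : ∑ m ∈ Finset.range d, x ^ m = 0 := by
  rw [geom_sum_eq hx1, hx, sub_self, zero_div]

section Eigenvectors

variable {K A : Type*} [Field K] [Ring A] [Algebra K A]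

theorem pow_mul_of_eigen {t y : A} {c : K} (h : t * y = c • y) (m : ℕ) :
    t ^ m * y = c ^ m • y := by
  induction m with
  | zero => simp
  | succ m ih => rw [pow_succ, mul_assoc, h, mul_smul_comm, ih, smul_smul, pow_succ']

/-- The projection onto the `ζ`-eigenspace of an element `t` with `t ^ d = 1`. -/
def eigenProj (d : ℕ) (t : A) (ζ : K) : A :=
  (d : K)⁻¹ • ∑ m ∈ Finset.range d, (ζ⁻¹ ^ m) • t ^ m

theorem mul_eigenProj {d : ℕ} {t : A} {ζ : K} (ht : t ^ d = 1) (hζ : ζ ^ d = 1) (h0 : ζ ≠ 0) :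
    t * eigenProj d t ζ = ζ • eigenProj d t ζ := by
  unfold eigenProj
  rw [mul_smul_comm, smul_comm ζ, Finset.mul_sum]
  congr 1
  have h1 : ∀ m, t * (ζ⁻¹ ^ m • t ^ m) = ζ • (ζ⁻¹ ^ (m + 1) • t ^ (m + 1)) := fun m => by
    rw [mul_smul_comm, smul_smul, pow_succ' t, pow_succ' ζ⁻¹, ← mul_assoc, mul_inv_cancel₀ h0,
      one_mul]
  simp only [h1, ← Finset.smul_sum]
  congr 1
  have h2 := Finset.sum_range_succ (fun m => ζ⁻¹ ^ m • t ^ m) d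
  rw [Finset.sum_range_succ'] at h2
  simpa [ht, hζ] using h2

theorem sum_eigenProj {d : ℕ} [CharZero K] (hd : 1 ≤ d) (t : A) {ζ : K}
    (hζ : IsPrimitiveRoot ζ d) : ∑ s : Fin d, eigenProj d t (ζ ^ s.val) = 1 := by
  have hd0 : (d : K) ≠ 0 := by exact_mod_cast (by omega : d ≠ 0)
  unfold eigenProj
  rw [← Finset.smul_sum, Finset.sum_comm, Finset.sum_eq_single_of_mem 0 (by simp; omega)]
  · simp [← Nat.cast_smul_eq_nsmul K, smul_smul, inv_mul_cancel₀ hd0]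
  · intro m hm hm0
    rw [← Finset.sum_smul, Fin.sum_univ_eq_sum_range (fun s => (ζ ^ s)⁻¹ ^ m)]
    have : ∀ s, (ζ ^ s)⁻¹ ^ m = ((ζ ^ m)⁻¹) ^ s := fun s => by
      rw [inv_pow, inv_pow, ← pow_mul, ← pow_mul, mul_comm]
    simp only [this]
    rw [geom_sum_eq_zero_of_pow_eq_one, zero_smul]
    · rw [inv_pow, ← pow_mul, mul_comm, pow_mul, hζ.pow_eq_one]; simp
    · intro e
      exact hζ.pow_ne_one_of_pos_of_lt hm0 (Finset.mem_range.1 hm) (inv_eq_one.1 e)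

/-- An element annihilating all joint eigenvectors of commuting elements of order dividing `d`
is zero. -/
theorem eq_zero_of_mul_eigenvectors {d n : ℕ} [CharZero K] (hd : 1 ≤ d) {ζ : K}
    (hζ : IsPrimitiveRoot ζ d) (T : Fin n → A) (hcomm : ∀ i j, T i * T j = T j * T i)
    (hpow : ∀ i, T i ^ d = 1) (x : A)
    (hx : ∀ (r : Fin n → Fin d) (y : A), (∀ k, T k * y = ζ ^ (r k).val • y) → x * y = 0) :
    x = 0 := by
  have key : ∀ m ≤ n, ∀ (r : Fin n → Fin d) (y : A),
      (∀ k : Fin n, m ≤ k.val → T k * y = ζ ^ (r k).val • y) → x * y = 0 := by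
    intro m
    induction m with
    | zero => exact fun _ r y hy => hx r y fun k => hy k (Nat.zero_le _)
    | succ m ih =>
      intro hm r y hy
      set j : Fin n := ⟨m, by omega⟩ with hj
      rw [← one_mul y, ← sum_eigenProj hd (T j) hζ, Finset.sum_mul, Finset.mul_sum]
      refine Finset.sum_eq_zero fun s _ => ih (by omega) (Function.update r j s) _ fun k hk => ?_
      by_cases hkj : k = j
      · subst hkj
        rw [Function.update_self, ← mul_assoc, mul_eigenProj (hpow _), smul_mul_assoc]
        · rw [← pow_mul, mul_comm, pow_mul, hζ.pow_eq_one, one_pow]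
        · exact pow_ne_zero _ (hζ.ne_zero (by omega))
      · have hc : Commute (T k) (eigenProj d (T j) (ζ ^ s.val)) :=
          (Commute.sum_right _ _ _ fun m _ =>
            ((show Commute (T k) (T j) from hcomm k j).pow_right m).smul_right _).smul_right _
        have hk' : m + 1 ≤ k.val := by
          have : k.val ≠ m := fun e => hkj (Fin.ext e)
          omega
        rw [Function.update_of_ne hkj, ← mul_assoc, hc.eq, mul_assoc, hy k hk', mul_smul_comm]
  simpa using key n le_rfl (fun _ => ⟨0, hd⟩) 1 fun k hk => absurd k.2 (by omega)

end Eigenvectors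

section Projections

variable {K A : Type*} [Field K] [CharZero K] [Ring A] [Algebra K A]

theorem average_mul_eigenvector {d : ℕ} (hd : 1 ≤ d) {ζ : K} (hζ : IsPrimitiveRoot ζ d)
    {t y : A} {r : Fin d} (h : t * y = ζ ^ r.val • y) :
    ((d : K)⁻¹ • ∑ m ∈ Finset.range d, t ^ m) * y = if r.val = 0 then y else 0 := by
  have hd0 : (d : K) ≠ 0 := by exact_mod_cast (by omega : d ≠ 0)
  rw [smul_mul_assoc, Finset.sum_mul, Finset.sum_congr rfl fun m _ => pow_mul_of_eigen h m,
    ← Finset.sum_smul, smul_smul]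
  split_ifs with h0
  · simp [h0, hd0]
  · rw [geom_sum_eq_zero_of_pow_eq_one, mul_zero, zero_smul]
    · rw [← pow_mul, mul_comm, pow_mul, hζ.pow_eq_one, one_pow]
    · exact hζ.pow_ne_one_of_pos_of_lt h0 r.2

theorem twisted_average_mul_eigenvector {d : ℕ} (hd : 1 ≤ d) {ζ : K} (hζ : IsPrimitiveRoot ζ d)
    {t t' y : A} {r s : Fin d} (h : t * y = ζ ^ r.val • y) (h' : t' * y = ζ ^ s.val • y) :
    ((d : K)⁻¹ • ∑ m ∈ Finset.range d, t ^ m * t' ^ (d - m)) * y = if r = s then y else 0 := by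
  have hd0 : (d : K) ≠ 0 := by exact_mod_cast (by omega : d ≠ 0)
  have hζ0 : ζ ≠ 0 := hζ.ne_zero (by omega)
  have hterm : ∀ m ∈ Finset.range d,
      t ^ m * t' ^ (d - m) * y = (ζ ^ r.val * (ζ ^ s.val)⁻¹) ^ m • y := by
    intro m hm
    have hs : (ζ ^ s.val) ^ d = 1 := by rw [← pow_mul, mul_comm, pow_mul, hζ.pow_eq_one, one_pow]
    rw [mul_assoc, pow_mul_of_eigen h', mul_smul_comm, pow_mul_of_eigen h, smul_smul,
      pow_sub₀ _ (pow_ne_zero _ hζ0) (Finset.mem_range.1 hm).le, hs, one_mul, mul_pow, inv_pow,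
      mul_comm]
  rw [smul_mul_assoc, Finset.sum_mul, Finset.sum_congr rfl hterm, ← Finset.sum_smul, smul_smul]
  split_ifs with h0
  · subst h0
    simp [hζ0, hd0]
  · rw [geom_sum_eq_zero_of_pow_eq_one, mul_zero, zero_smul]
    · rw [mul_pow, inv_pow, ← pow_mul, ← pow_mul, mul_comm r.val, mul_comm s.val, pow_mul, pow_mul,
        hζ.pow_eq_one]
      simp
    · rw [Ne, mul_inv_eq_one₀ (pow_ne_zero _ hζ0)]
      exact fun e => h0 (Fin.ext (hζ.pow_inj r.2 s.2 e))

end Projections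

section Framization

variable {d n : ℕ}

/-- The braiding generators of `Y_{d,n}^B`, with `b₁` in position `0`. -/
def braidGen (d n : ℕ) (i : Fin n) : YB d n := if i.val = 0 then bY d n else gY d n i.val

/-- The framing generators of `Y_{d,n}^B`. -/
def frameGen (d n : ℕ) (k : Fin n) : YB d n := tY d n (k.val + 1)

theorem typeBBraid_braidGen : TypeBBraid (braidGen d n) where
  comm i j h := by
    unfold braidGen
    rw [if_neg (by omega : j.val ≠ 0)]
    split_ifs with h0
    · simpa only [bY, gY, tY, frameGen, map_mul] using mkY_eq_of_rel (d := d) (.bg j.val (by omega) (by omega))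
    · simpa only [bY, gY, tY, frameGen, map_mul] using mkY_eq_of_rel (d := d)
        (.gg i.val j.val (by omega) (by omega) (by omega) (by omega) (Or.inl h))
  braid i j h0 h := by
    unfold braidGen
    rw [if_neg h0, if_neg (by omega : j.val ≠ 0), h]
    simpa only [bY, gY, tY, frameGen, map_mul] using mkY_eq_of_rel (d := d)
      (.braid i.val (by omega) (by omega))
  braid₄ i j h0 h := by
    unfold braidGen
    rw [if_pos h0, if_neg (by omega : j.val ≠ 0), h]
    simpa only [bY, gY, tY, frameGen, map_mul] using mkY_eq_of_rel (.bgbg (d := d) (n := n))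

theorem frameGen_mul_braidGen (i k : Fin n) : frameGen d n k * braidGen d n i =
    braidGen d n i *
      frameGen d n (if i.val = 0 then k else Equiv.swap ⟨i.val - 1, by omega⟩ i k) := by
  unfold braidGen frameGen
  split_ifs with h0
  · simpa only [bY, gY, tY, frameGen, map_mul] using mkY_eq_of_rel (d := d) (.tb (k.val + 1) (by omega) (by omega))
  · have h1 := mkY_eq_of_rel (d := d)
      (.tg (n := n) i.val (k.val + 1) (by omega) (by omega) (by omega) (by omega))
    have h2 : sAct i.val (k.val + 1)
        = (Equiv.swap (⟨i.val - 1, by omega⟩ : Fin n) i k).val + 1 := by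
      unfold sAct
      rw [Equiv.swap_apply_def]
      simp only [Fin.ext_iff]
      split_ifs <;> (try simp only) <;> omega
    rw [h2, map_mul, map_mul] at h1
    exact h1

theorem frameGen_comm (i j : Fin n) :
    frameGen d n i * frameGen d n j = frameGen d n j * frameGen d n i := by
  simpa only [bY, gY, tY, frameGen, map_mul] using mkY_eq_of_rel (d := d)
    (.tt (i.val + 1) (j.val + 1) (by omega) (by omega) (by omega) (by omega))

theorem frameGen_pow (i : Fin n) : frameGen d n i ^ d = 1 := by
  simpa only [tY, frameGen, map_pow, map_one] using mkY_eq_of_rel (d := d)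
    (.td (i.val + 1) (by omega) (by omega))

theorem isPrimitiveRoot_cK {w : ℂ} (hw : IsPrimitiveRoot w d) : IsPrimitiveRoot (cK w) d :=
  hw.map_of_injective (f := (algebraMap (MvPolynomial (Fin 2) ℂ) Kf).comp MvPolynomial.C)
    ((IsFractionRing.injective (MvPolynomial (Fin 2) ℂ) Kf).comp (MvPolynomial.C_injective _ _))

/-- A family of elements of `Y_{d,n}^B` indexed by the natural basis of the tensor space which is
compatible with the type `B` reflections and consists of eigenvectors of the framing generators. -/
structure IsEquivariantFamily (ζ : Kf) (H : BIdx d n → YB d n) : Prop where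
  eigen : ∀ f k, frameGen d n k * H f = ζ ^ (f k).2.val • H f
  descent : ∀ f i, IsDescent i f → H f = braidGen d n i * H (reflect i f)

theorem bY_mul_of_neg (hn : 2 ≤ n) (hd : 1 ≤ d) {ζ : Kf} (hζ : IsPrimitiveRoot ζ d)
    {H : BIdx d n → YB d n} (hH : IsEquivariantFamily ζ H) {f : BIdx d n}
    (hf : IsDescent ⟨0, by omega⟩ f) :
    bY d n * H f = H (reflect ⟨0, by omega⟩ f)
      + (if (f ⟨0, by omega⟩).2.val = 0 then (vv - vv⁻¹) • H f else 0) := by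
  have h1 := hH.descent f _ hf
  simp only [braidGen, if_pos] at h1
  have h2 := mkY_eq_of_rel (.bsq (d := d) (n := n))
  rw [map_pow, map_add, map_one, map_smul, map_mul] at h2
  change bY d n ^ 2 = 1 + (vv - vv⁻¹) • (mkY d n (fF d n) * bY d n) at h2
  have h3 : mkY d n (fF d n) * H f = if (f ⟨0, by omega⟩).2.val = 0 then H f else 0 := by
    unfold fF
    rw [map_smul, map_sum]
    simp only [map_pow]
    exact average_mul_eigenvector hd hζ (hH.eigen f ⟨0, by omega⟩)
  nth_rewrite 1 [h1]
  rw [← mul_assoc, ← pow_two, h2, add_mul, one_mul, smul_mul_assoc, mul_assoc, ← h1, h3, smul_ite,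
    smul_zero]

theorem gY_mul_of_isDescent (hd : 1 ≤ d) {ζ : Kf} (hζ : IsPrimitiveRoot ζ d)
    {H : BIdx d n → YB d n} (hH : IsEquivariantFamily ζ H) {f : BIdx d n} {i : Fin n}
    (h0 : i.val ≠ 0) (hf : IsDescent i f) :
    gY d n i.val * H f = H (reflect i f)
      + (if (f ⟨i.val - 1, by omega⟩).2 = (f i).2 then (uu - uu⁻¹) • H f else 0) := by
  have h1 := hH.descent f _ hf
  simp only [braidGen, if_neg h0] at h1
  have h2 := mkY_eq_of_rel (.gsq (d := d) (n := n) i.val (by omega) (by omega))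
  rw [map_pow, map_add, map_one, map_smul, map_mul] at h2
  change gY d n i.val ^ 2 = 1 + (uu - uu⁻¹) • (mkY d n (eF d n i.val) * gY d n i.val) at h2
  have h3 : mkY d n (eF d n i.val) * H f
      = if (f ⟨i.val - 1, by omega⟩).2 = (f i).2 then H f else 0 := by
    unfold eF
    rw [map_smul, map_sum]
    simp only [map_pow, map_mul]
    refine twisted_average_mul_eigenvector hd hζ ?_ (hH.eigen f i)
    have := hH.eigen f ⟨i.val - 1, by omega⟩
    simpa only [frameGen, tY, Nat.sub_add_cancel (Nat.one_le_iff_ne_zero.2 h0)] using this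
  nth_rewrite 1 [h1]
  rw [← mul_assoc, ← pow_two, h2, add_mul, one_mul, smul_mul_assoc, mul_assoc, ← h1, h3, smul_ite,
    smul_zero]

theorem braidGen_mul_of_not_isDescent {ζ : Kf} {H : BIdx d n → YB d n}
    (hH : IsEquivariantFamily ζ H) {f : BIdx d n} {i : Fin n} (hf : AbsInjective f)
    (hi : ¬ IsDescent i f) : braidGen d n i * H f = H (reflect i f) := by
  rw [hH.descent _ i (isDescent_reflect hf hi), reflect_reflect]

open Classical in
/-- The linear map from the tensor space to `Y_{d,n}^B` given by a family of elements on the basis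
indices with distinct absolute values, and by `0` on the others. -/
def familyMap (H : BIdx d n → YB d n) : Vn d n →ₗ[Kf] YB d n :=
  Finsupp.linearCombination Kf fun f => if AbsInjective f then H f else 0

open Classical in
theorem familyMap_bv (H : BIdx d n → YB d n) (f : BIdx d n) :
    familyMap H (bv d n f) = if AbsInjective f then H f else 0 := by
  simp [familyMap, bv]

theorem opOf_bv (F : BIdx d n → Vn d n) (f : BIdx d n) : opOf d n F (bv d n f) = F f := by
  simp [opOf, bv]

theorem familyMap_BOp (hn : 2 ≤ n) (hd : 1 ≤ d) {ζ : Kf} (hζ : IsPrimitiveRoot ζ d)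
    {H : BIdx d n → YB d n} (hH : IsEquivariantFamily ζ H) (f : BIdx d n) :
    familyMap H (BOp d n (bv d n f)) = bY d n * familyMap H (bv d n f) := by
  set p : Fin n := ⟨0, by omega⟩ with hp
  have hr : Function.update f p (negX n (f p).1, (f p).2) = reflect p f := by
    unfold reflect
    rw [if_pos rfl]
  have hne := (f p).1.2.1
  have hdp : IsDescent p f ↔ (f p).1.val < 0 := by simp [IsDescent, hp]
  rw [BOp, dif_pos (by omega), opOf_bv]
  simp only [← hp, hr]
  by_cases hf : AbsInjective f
  · by_cases hD : IsDescent p f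
    · have key := bY_mul_of_neg hn hd hζ hH hD
      rw [← hp] at key
      have := hdp.1 hD
      rw [familyMap_bv, if_pos hf, key]
      split_ifs <;>
        first | omega | simp_all [familyMap_bv, absInjective_reflect_iff]
    · have key := braidGen_mul_of_not_isDescent hH hf hD
      rw [braidGen, if_pos rfl] at key
      rw [hdp] at hD
      rw [familyMap_bv, if_pos hf, key]
      split_ifs <;>
        first | omega | simp_all [familyMap_bv, absInjective_reflect_iff]
  · split_ifs <;> simp [familyMap_bv, absInjective_reflect_iff, hf]

theorem familyMap_GOp (hd : 1 ≤ d) {ζ : Kf} (hζ : IsPrimitiveRoot ζ d)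
    {H : BIdx d n → YB d n} (hH : IsEquivariantFamily ζ H) {i : Fin n} (h0 : i.val ≠ 0)
    (f : BIdx d n) :
    familyMap H (GOp d n i.val (bv d n f)) = gY d n i.val * familyMap H (bv d n f) := by
  set p : Fin n := ⟨i.val - 1, by omega⟩ with hp
  have hr : f ∘ Equiv.swap p i = reflect i f := by
    unfold reflect
    rw [if_neg h0]
  have hdi : IsDescent i f ↔ (f i).1.val < (f p).1.val := by simp [IsDescent, hp, h0]
  rw [GOp, dif_pos (by omega), opOf_bv]
  simp only [← hp, Fin.eta, hr]
  by_cases hf : AbsInjective f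
  · have hne : (f p).1.val ≠ (f i).1.val := by
      intro e
      have := congrArg Fin.val (hf (congrArg Int.natAbs e))
      simp only [hp] at this
      omega
    by_cases hD : IsDescent i f
    · have key := gY_mul_of_isDescent hd hζ hH h0 hD
      rw [← hp] at key
      have := hdi.1 hD
      rw [familyMap_bv, if_pos hf, key]
      split_ifs <;>
        first | omega | contradiction | simp_all [familyMap_bv, absInjective_reflect_iff]
    · have key := braidGen_mul_of_not_isDescent hH hf hD
      rw [braidGen, if_neg h0] at key
      rw [hdi] at hD
      rw [familyMap_bv, if_pos hf, key]
      split_ifs <;>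
        first | omega | contradiction | simp_all [familyMap_bv, absInjective_reflect_iff]
  · split_ifs <;> simp [familyMap_bv, absInjective_reflect_iff, hf]

theorem familyMap_TOp {w : ℂ} {H : BIdx d n → YB d n} (hH : IsEquivariantFamily (cK w) H)
    (k : Fin n) (f : BIdx d n) :
    familyMap H (TOp w d n (k.val + 1) (bv d n f))
      = frameGen d n k * familyMap H (bv d n f) := by
  rw [TOp, dif_pos (by omega), opOf_bv, map_smul, familyMap_bv]
  split_ifs
  · exact (hH.eigen f k).symm
  · simp

theorem familyMap_apply (hn : 2 ≤ n) (hd : 1 ≤ d) {w : ℂ} (hw : IsPrimitiveRoot w d)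
    {Φ : YB d n →ₐ[Kf] Module.End Kf (Vn d n)} (hΦb : Φ (bY d n) = BOp d n)
    (hΦg : ∀ i, 1 ≤ i → i ≤ n - 1 → Φ (gY d n i) = GOp d n i)
    (hΦt : ∀ k, 1 ≤ k → k ≤ n → Φ (tY d n k) = TOp w d n k)
    {H : BIdx d n → YB d n} (hH : IsEquivariantFamily (cK w) H) (x : YB d n) (z : Vn d n) :
    familyMap H (Φ x z) = x * familyMap H z := by
  have ext : ∀ (a : YB d n) (L : Module.End Kf (Vn d n)),
      (∀ f, familyMap H (L (bv d n f)) = a * familyMap H (bv d n f)) →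
      ∀ z, familyMap H (L z) = a * familyMap H z := by
    intro a L h
    have : (familyMap H).comp L = (LinearMap.mulLeft Kf a).comp (familyMap H) := by
      refine Finsupp.lhom_ext' fun f => LinearMap.ext_ring ?_
      simpa [bv] using h f
    exact fun z => LinearMap.congr_fun this z
  obtain ⟨a, rfl⟩ := RingQuot.mkAlgHom_surjective Kf (YBrel d n) x
  change familyMap H (Φ (mkY d n a) z) = mkY d n a * familyMap H z
  induction a using FreeAlgebra.induction generalizing z with
  | grade0 c => simp [Algebra.algebraMap_eq_smul_one]
  | grade1 s =>
    refine ext _ _ ?_ z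
    cases s with
    | b =>
      change ∀ f, familyMap H (Φ (bY d n) (bv d n f)) = bY d n * familyMap H (bv d n f)
      rw [hΦb]
      exact familyMap_BOp hn hd (isPrimitiveRoot_cK hw) hH
    | g i =>
      have e : mkY d n (FreeAlgebra.ι Kf (Gen.g i)) = gY d n (i.val + 1) := by
        rw [gY, Gg, dif_pos (by omega)]
        rfl
      rw [e, hΦg _ (by omega) (by omega)]
      exact familyMap_GOp hd (isPrimitiveRoot_cK hw) hH
        (i := ⟨i.val + 1, by omega⟩) (Nat.succ_ne_zero _)
    | t k =>
      have e : mkY d n (FreeAlgebra.ι Kf (Gen.t k)) = tY d n (k.val + 1) := by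
        rw [tY, Tt, dif_pos (by omega)]
        rfl
      rw [e, hΦt _ (by omega) (by omega)]
      exact familyMap_TOp hH k
  | mul a b ha hb => rw [map_mul, map_mul, Module.End.mul_apply, ha, hb, mul_assoc]
  | add a b ha hb => rw [map_add, map_add, LinearMap.add_apply, map_add, ha, hb, add_mul]

/-- The basis index `v_1^{r_1} ⊗ ⋯ ⊗ v_n^{r_n}`. -/
def standardIdx (r : Fin n → Fin d) : BIdx d n :=
  fun p => (⟨(p.val : ℤ) + 1, by omega, by omega⟩, r p)

theorem absInjective_standardIdx (r : Fin n → Fin d) : AbsInjective (standardIdx r) := by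
  intro p q h
  simp only [standardIdx] at h
  exact Fin.ext (by omega)

theorem not_isDescent_standardIdx (r : Fin n → Fin d) (i : Fin n) :
    ¬ IsDescent i (standardIdx r) := by
  simp only [IsDescent, standardIdx]
  omega

open Classical in
/-- The family with value `y` at the standard index with labels `r`, extended along the type `B`
reflections. -/
def orbitFamily (r : Fin n → Fin d) (y : YB d n) : BIdx d n → YB d n :=
  descentProd (braidGen d n) fun f => if (fun k => (f k).2) = r then y else 0

theorem isEquivariantFamily_orbitFamily {ζ : Kf} {r : Fin n → Fin d} {y : YB d n}
    (hy : ∀ k, frameGen d n k * y = ζ ^ (r k).val • y) :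
    IsEquivariantFamily ζ (orbitFamily r y) where
  eigen := by
    refine descentProd_eigen (frameGen d n) (fun s => ζ ^ s.val) frameGen_mul_braidGen ?_
    intro f k
    split_ifs with h
    · rw [hy, ← h]
    · simp
  descent _ _ h := descentProd_eq_of_isDescent _ typeBBraid_braidGen h

theorem orbitFamily_standardIdx (r : Fin n → Fin d) (y : YB d n) :
    orbitFamily r y (standardIdx r) = y := by
  rw [orbitFamily, descentProd, dif_neg fun ⟨i, hi⟩ => not_isDescent_standardIdx r i hi]
  exact if_pos rfl

end Framization

/-- the tensorial representation `Φ : Y_{d,n}^B → End(V^{⊗n})`, i.e. the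
algebra homomorphism determined by `Φ(b₁) = B₁`, `Φ(g_i) = G_i`, `Φ(t_k) = T_k`,
is faithful (injective). -/
theorem stmt9 (d n : ℕ) (hd : 1 ≤ d) (hn : 2 ≤ n) (w : ℂ) (hw : IsPrimitiveRoot w d)
    (Φ : YB d n →ₐ[Kf] Module.End Kf (Vn d n))
    (hΦb : Φ (bY d n) = BOp d n)
    (hΦg : ∀ i, 1 ≤ i → i ≤ n - 1 → Φ (gY d n i) = GOp d n i)
    (hΦt : ∀ k, 1 ≤ k → k ≤ n → Φ (tY d n k) = TOp w d n k) :
    Function.Injective Φ := by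
  refine (injective_iff_map_eq_zero Φ).2 fun x hx => ?_
  refine eq_zero_of_mul_eigenvectors hd (isPrimitiveRoot_cK hw) (frameGen d n) frameGen_comm
    frameGen_pow x fun r y hy => ?_
  have h := familyMap_apply hn hd hw hΦb hΦg hΦt (isEquivariantFamily_orbitFamily hy) x
    (bv d n (standardIdx r))
  rw [hx, LinearMap.zero_apply, map_zero, familyMap_bv, if_pos (absInjective_standardIdx r),
    orbitFamily_standardIdx] at h
  exact h.symm
end
end
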